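/- Norm bound on the complementary block. Under assumptions (A1) and (A2), for every ν > 0 there exists a constant C_ν > 0 such that with ν-high probability ‖ Π̄^p A^p Π̄^p ‖ ≤ C_ν √(log N / log log N). -/

import Mathlib

open MeasureTheory Real

namespace GRG

variable {N : ℕ}

/-! ### Generic graph-theoretic definitions over an adjacency relation on `Fin N` -/

/-- The degree of a vertex with respect to an adjacency relation. -/
noncomputable def degA (A : Fin N → Fin N → Prop) (x : Fin N) : ℕ :=
  {y | A x y}.ncard

/-- The strict total order `≺`: `x ≺ y` iff `D_x < D_y`, or `D_x = D_y` and `x > y`. -/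
def precA (A : Fin N → Fin N → Prop) (x y : Fin N) : Prop :=
  degA A x < degA A y ∨ (degA A x = degA A y ∧ y < x)

/-- `γ 0, γ 1, …, γ l` is a path for the adjacency relation `A`. -/
def IsPathOn (A : Fin N → Fin N → Prop) (l : ℕ) (γ : ℕ → Fin N) : Prop :=
  ∀ i < l, A (γ i) (γ (i + 1))

/-- A path of length `l` is simple: all vertices distinct except possibly endpoints. -/
def IsSimplePath (l : ℕ) (γ : ℕ → Fin N) : Prop :=
  ∀ i j, i < j → j ≤ l → ¬(i = 0 ∧ j = l) → γ i ≠ γ j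

/-- Two paths are edge-disjoint. -/
def EdgeDisjoint (l l' : ℕ) (γ γ' : ℕ → Fin N) : Prop :=
  ∀ i < l, ∀ j < l',
    ¬((γ i = γ' j ∧ γ (i + 1) = γ' (j + 1)) ∨ (γ i = γ' (j + 1) ∧ γ (i + 1) = γ' j))

/-- `S_1^cyc(x)`: neighbours of `x` that start a simple cycle through `x`
of length at most `2r+1`. -/
def S1cycA (A : Fin N → Fin N → Prop) (r : ℕ) (x : Fin N) : Set (Fin N) :=
  {y | A x y ∧ ∃ l γ, 3 ≤ l ∧ l ≤ 2 * r + 1 ∧ γ 0 = x ∧ γ 1 = y ∧ γ l = x ∧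
    IsPathOn A l γ ∧ IsSimplePath l γ}

/-- `S_1^du(x)`: neighbours `y ∉ S_1^cyc(x)` of `x` that have a neighbour
`z ∉ S_1^cyc(y)` with `y ≺ x ≺ z`. -/
def S1duA (A : Fin N → Fin N → Prop) (r : ℕ) (x : Fin N) : Set (Fin N) :=
  {y | A x y ∧ y ∉ S1cycA A r x ∧ precA A y x ∧
    ∃ z, A y z ∧ z ∉ S1cycA A r y ∧ precA A x z}

/-- Adjacency in the graph `G^nc` (after removing the cycle-creating edges). -/
def AdjNCA (A : Fin N → Fin N → Prop) (r : ℕ) (x y : Fin N) : Prop :=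
  A x y ∧ y ∉ S1cycA A r x ∧ x ∉ S1cycA A r y

/-- Adjacency in the pruned graph `G^p` (after further removing the down-up edges). -/
def AdjPA (A : Fin N → Fin N → Prop) (r : ℕ) (x y : Fin N) : Prop :=
  AdjNCA A r x y ∧ y ∉ S1duA A r x ∧ x ∉ S1duA A r y

/-- Degree in the pruned graph. -/
noncomputable def degPA (A : Fin N → Fin N → Prop) (r : ℕ) (x : Fin N) : ℕ :=
  {y | AdjPA A r x y}.ncard

/-- `S_1^{p−}(x)`: pruned-graph neighbours of `x` that are smaller than `x` for `≺`. -/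
def S1pmA (A : Fin N → Fin N → Prop) (r : ℕ) (x : Fin N) : Set (Fin N) :=
  {y | AdjPA A r x y ∧ precA A y x}

/-- `D_x^{p−}`. -/
noncomputable def degPmA (A : Fin N → Fin N → Prop) (r : ℕ) (x : Fin N) : ℕ :=
  (S1pmA A r x).ncard

/-- `Sib^−(x)`: the smaller siblings of `x` (children of the parent of `x`
that are smaller than `x`). -/
def SibmA (A : Fin N → Fin N → Prop) (r : ℕ) (x : Fin N) : Set (Fin N) :=
  {y | ∃ p, AdjPA A r x p ∧ precA A x p ∧ AdjPA A r p y ∧ precA A y p ∧ precA A y x}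

/-- The normalization constant `Z_x` (note `2/0 = 0` in Lean, so this agrees with the
convention `Z_x = 2` when `Sib^−(x) = ∅`). -/
noncomputable def ZxA (A : Fin N → Fin N → Prop) (r : ℕ) (x : Fin N) : ℝ :=
  2 + 2 / (SibmA A r x).ncard

/-- The indicator vector of a set of vertices. -/
noncomputable def indVec (S : Set (Fin N)) : Fin N → ℝ :=
  S.indicator 1

/-- The approximate eigenvector `u_σ(x)`. -/
noncomputable def uVecA (A : Fin N → Fin N → Prop) (r : ℕ) (σ : ℝ) (x : Fin N) :
    Fin N → ℝ := fun y =>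
  (Real.sqrt (ZxA A r x))⁻¹ *
    (indVec {x} y + σ * (Real.sqrt (degPmA A r x))⁻¹ * indVec (S1pmA A r x) y -
      indVec (SibmA A r x) y / (SibmA A r x).ncard)

/-- The star vector `v_σ(x)`. -/
noncomputable def vVecA (A : Fin N → Fin N → Prop) (r : ℕ) (σ : ℝ) (x : Fin N) :
    Fin N → ℝ := fun y =>
  (Real.sqrt 2)⁻¹ *
    (indVec {x} y + σ * (Real.sqrt (degPmA A r x))⁻¹ * indVec (S1pmA A r x) y)

/-- Euclidean scalar product on `ℝ^N`. -/
noncomputable def dotR (f g : Fin N → ℝ) : ℝ := ∑ y, f y * g y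

/-- The Euclidean (`ℓ² → ℓ²`) operator norm of an `N × N` real matrix. -/
noncomputable def opNorm (M : Matrix (Fin N) (Fin N) ℝ) : ℝ :=
  ‖Matrix.toEuclideanCLM (𝕜 := ℝ) M‖

open Classical in
/-- The adjacency matrix of the pruned graph. -/
noncomputable def adjMatrixPA (A : Fin N → Fin N → Prop) (r : ℕ) :
    Matrix (Fin N) (Fin N) ℝ := fun x y => if AdjPA A r x y then 1 else 0

/-- The threshold `ξ_ν`. -/
noncomputable def xi (ν δ : ℝ) (N : ℕ) : ℝ :=
  3 * (ν + 1) * (2 - 3 * δ) / ((1 - δ) * (1 - 2 * δ)) *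
    (Real.log N / Real.log (Real.log N))

/-- The set `V_ν^{(h)}` of high-degree vertices. -/
def VhA (A : Fin N → Fin N → Prop) (ν δ : ℝ) : Set (Fin N) :=
  {x | xi ν δ N ≤ (degA A x : ℝ)}

/-- The projection `Π^p` onto the span of the vectors `u_σ(x)`, `x ∈ V_ν^{(h)}`. -/
noncomputable def PiPA (A : Fin N → Fin N → Prop) (r : ℕ) (ν δ : ℝ) :
    Matrix (Fin N) (Fin N) ℝ :=
  ∑ x : Fin N, Set.indicator (VhA A ν δ) (fun _ => (1 : ℝ)) x •
    (Matrix.vecMulVec (uVecA A r 1 x) (uVecA A r 1 x) +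
      Matrix.vecMulVec (uVecA A r (-1) x) (uVecA A r (-1) x))

/-- The block-diagonal approximation `Â`. -/
noncomputable def AhatA (A : Fin N → Fin N → Prop) (r : ℕ) (ν δ : ℝ) :
    Matrix (Fin N) (Fin N) ℝ :=
  (∑ x : Fin N, Set.indicator (VhA A ν δ) (fun _ => (1 : ℝ)) x •
    (Real.sqrt (degPmA A r x) •
      (Matrix.vecMulVec (uVecA A r 1 x) (uVecA A r 1 x) -
        Matrix.vecMulVec (uVecA A r (-1) x) (uVecA A r (-1) x)))) +
  (1 - PiPA A r ν δ) * adjMatrixPA A r * (1 - PiPA A r ν δ)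

/-! ### The generalized random graph (GRG) model -/

/-- Index set of potential edges. -/
abbrev EdgeIdx (N : ℕ) := {p : Fin N × Fin N // p.1 < p.2}

/-- The edge probabilities `p_{xy} = w_x w_y / (Σ_z w_z + w_x w_y)`. -/
noncomputable def pGRG (w : Fin N → ℝ) (x y : Fin N) : ℝ :=
  w x * w y / ((∑ z, w z) + w x * w y)

/-- Bernoulli measure with parameter `p` on `Bool`. -/
noncomputable def bern (p : ℝ) : Measure Bool :=
  ENNReal.ofReal p • Measure.dirac true + ENNReal.ofReal (1 - p) • Measure.dirac false

instance (p : ℝ) : IsFiniteMeasure (bern p) := by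
  constructor
  simp only [bern, Measure.coe_add, Measure.coe_smul, Pi.add_apply, Pi.smul_apply,
    smul_eq_mul, measure_univ, mul_one]
  exact ENNReal.add_lt_top.mpr ⟨ENNReal.ofReal_lt_top, ENNReal.ofReal_lt_top⟩

/-- The law of the GRG: independent Bernoulli edge indicators. -/
noncomputable def grgMeasure (w : Fin N → ℝ) : Measure (EdgeIdx N → Bool) :=
  Measure.pi fun e => bern (pGRG w e.val.1 e.val.2)

/-- The (random) adjacency matrix. -/
noncomputable def adjMatrix (ω : EdgeIdx N → Bool) : Matrix (Fin N) (Fin N) ℝ :=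
  fun x y =>
    if h : x < y then (if ω ⟨(x, y), h⟩ then 1 else 0)
    else if h' : y < x then (if ω ⟨(y, x), h'⟩ then 1 else 0)
    else 0

/-- The (random) adjacency relation. -/
def Adj (ω : EdgeIdx N → Bool) (x y : Fin N) : Prop := adjMatrix ω x y = 1

/-- The (random) degree `D_x`. -/
noncomputable def deg (ω : EdgeIdx N → Bool) (x : Fin N) : ℕ := degA (Adj ω) x

/-- The first empirical moment `m_1`. -/
noncomputable def m1 (w : Fin N → ℝ) : ℝ := (∑ x, w x) / N

/-- The second empirical moment `m_2`. -/
noncomputable def m2 (w : Fin N → ℝ) : ℝ := (∑ x, w x ^ 2) / N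

/-- The expected degree `d_x = E[D_x]`. -/
noncomputable def dExp (w : Fin N → ℝ) (x : Fin N) : ℝ :=
  ∫ ω, (deg ω x : ℝ) ∂(grgMeasure w)

/-- The set `W_{λ,η}` of resonant vertices. -/
def resonant (ω : EdgeIdx N → Bool) (lam η : ℝ) : Set (Fin N) :=
  {x | |Real.sqrt (deg ω x) - lam| ≤ η}

/-- The set `V*_{ν,η}` of isolated vertices. -/
noncomputable def Vstar (w : Fin N → ℝ) (ν η : ℝ) : Set (Fin N) :=
  {x | (4 * ν / 9) * Real.log N ≤ dExp w x ∧
    ∀ y, y ≠ x →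
      max (4 * Real.sqrt (ν * Real.log N * dExp w x) +
            4 * Real.sqrt (ν * Real.log N * dExp w y))
          (16 * η ^ 2) ≤ |dExp w x - dExp w y|}

end GRG

namespace GRG
variable {N : ℕ}

lemma opNorm_schur (M : Matrix (Fin N) (Fin N) ℝ) (R C : ℝ) (hR : 0 ≤ R) (hC : 0 ≤ C)
    (hrow : ∀ x, ∑ y, |M x y| ≤ R) (hcol : ∀ y, ∑ x, |M x y| ≤ C) :
    opNorm M ≤ √(R * C) := by
  unfold opNorm
  refine ContinuousLinearMap.opNorm_le_bound _ (Real.sqrt_nonneg _) fun v => ?_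
  rw [EuclideanSpace.norm_eq, EuclideanSpace.norm_eq, ← Real.sqrt_mul (by positivity)]
  apply Real.sqrt_le_sqrt
  simp only [Real.norm_eq_abs, sq_abs]
  have h1 : ∀ x, ((Matrix.toEuclideanCLM (𝕜 := ℝ) M) v x) ^ 2
      ≤ R * ∑ y, |M x y| * v y ^ 2 := by
    intro x
    have e : (Matrix.toEuclideanCLM (𝕜 := ℝ) M) v x = ∑ y, M x y * v y := by
      rw [Matrix.ofLp_toEuclideanCLM]
      simp [Matrix.mulVec, dotProduct]
    rw [e]
    calc (∑ y, M x y * v y) ^ 2 ≤ (∑ y, |M x y|) * ∑ y, |M x y| * v y ^ 2 := by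
          apply Finset.sum_sq_le_sum_mul_sum_of_sq_le_mul
          · intros; positivity
          · intros; positivity
          · intro i _
            rw [mul_pow, ← mul_assoc, ← sq, sq_abs]
      _ ≤ _ := by
          apply mul_le_mul_of_nonneg_right (hrow x)
          exact Finset.sum_nonneg fun _ _ => by positivity
  calc _ ≤ ∑ x, R * ∑ y, |M x y| * v y ^ 2 := Finset.sum_le_sum fun x _ => h1 x
    _ = R * ∑ y, (∑ x, |M x y|) * v y ^ 2 := by
        rw [← Finset.mul_sum, Finset.sum_comm]
        simp_rw [Finset.sum_mul]
    _ ≤ R * ∑ y, C * v y ^ 2 := by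
        apply mul_le_mul_of_nonneg_left _ hR
        exact Finset.sum_le_sum fun y _ => mul_le_mul_of_nonneg_right (hcol y) (sq_nonneg _)
    _ = _ := by rw [← Finset.mul_sum]; ring

lemma opNorm_mul_le (M M' : Matrix (Fin N) (Fin N) ℝ) :
    opNorm (M * M') ≤ opNorm M * opNorm M' := by
  unfold opNorm
  rw [map_mul]
  exact norm_mul_le _ _

lemma opNorm_add_le (M M' : Matrix (Fin N) (Fin N) ℝ) :
    opNorm (M + M') ≤ opNorm M + opNorm M' := by
  unfold opNorm
  rw [map_add]
  exact norm_add_le _ _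

lemma opNorm_sub_le (M M' : Matrix (Fin N) (Fin N) ℝ) :
    opNorm (M - M') ≤ opNorm M + opNorm M' := by
  unfold opNorm
  rw [map_sub]
  exact norm_sub_le _ _

lemma opNorm_transpose (M : Matrix (Fin N) (Fin N) ℝ) :
    opNorm M.transpose = opNorm M := by
  unfold opNorm
  have : M.transpose = star M := by
    ext i j; simp [Matrix.star_apply]
  rw [this, map_star, ContinuousLinearMap.star_eq_adjoint]
  exact LinearIsometryEquiv.norm_map _ _

lemma opNorm_one_le : opNorm (1 : Matrix (Fin N) (Fin N) ℝ) ≤ 1 := by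
  unfold opNorm
  rw [map_one]
  exact ContinuousLinearMap.norm_id_le

lemma opNorm_nonneg (M : Matrix (Fin N) (Fin N) ℝ) : 0 ≤ opNorm M := norm_nonneg _

section det
variable {A : Fin N → Fin N → Prop} {r : ℕ}

lemma precA_trich {x y : Fin N} (h : x ≠ y) : precA A x y ∨ precA A y x := by
  unfold precA; have : (x:ℕ) ≠ y := fun h' => h (Fin.ext h'); simp only [Fin.lt_def]; omega

lemma precA_asymm {x y : Fin N} (h : precA A x y) : ¬ precA A y x := by
  unfold precA at *; simp only [Fin.lt_def] at *; omega

lemma precA_irrefl {x : Fin N} : ¬ precA A x x := by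
  unfold precA at *; simp only [Fin.lt_def] at *; omega

lemma AdjPA.symm (hs : ∀ x y, A x y → A y x) {x y : Fin N} (h : AdjPA A r x y) :
    AdjPA A r y x := ⟨⟨hs _ _ h.1.1, h.1.2.2, h.1.2.1⟩, h.2.2, h.2.1⟩

lemma parent_unique (hs : ∀ x y, A x y → A y x) {y p q : Fin N}
    (hp : y ∈ S1pmA A r p) (hq : y ∈ S1pmA A r q) : p = q := by
  have key : ∀ p q, y ∈ S1pmA A r p → y ∈ S1pmA A r q → ¬ precA A p q := by
    intro p q hp hq h
    exact hp.1.2.1 ⟨hp.1.1.1, hp.1.1.2.1, hp.2, q, hs _ _ hq.1.1.1, hq.1.1.2.2, h⟩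
  by_contra hne
  rcases precA_trich (A := A) hne with h | h
  · exact key _ _ hp hq h
  · exact key _ _ hq hp h

lemma Sibm_eq (hs : ∀ x y, A x y → A y x) {x p : Fin N} (hp : x ∈ S1pmA A r p) :
    SibmA A r x = {y | y ∈ S1pmA A r p ∧ precA A y x} := by
  ext y
  constructor
  · rintro ⟨q, h1, h2, h3, h4, h5⟩
    have : p = q := parent_unique hs hp ⟨h1.symm hs, h2⟩
    subst this
    exact ⟨⟨h3, h4⟩, h5⟩
  · rintro ⟨⟨h1, h2⟩, h3⟩
    exact ⟨p, hp.1.symm hs, hp.2, h1, h2, h3⟩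

lemma Sibm_eq_empty (hs : ∀ x y, A x y → A y x) {x : Fin N} (hp : ∀ p, x ∉ S1pmA A r p) :
    SibmA A r x = ∅ := by
  ext y
  simp only [Set.mem_empty_iff_false, iff_false]
  rintro ⟨q, h1, h2, h3, h4, h5⟩
  exact hp q ⟨h1.symm hs, h2⟩

lemma degPmA_le (x : Fin N) : degPmA A r x ≤ degA A x :=
  Set.ncard_le_ncard (fun _ h => h.1.1.1) (Set.toFinite _)

/-- number of smaller siblings of a high vertex -/
lemma Sib_large (hs : ∀ x y, A x y → A y x) {X : ℝ}
    (hH : ∀ y, X ≤ (degA A y : ℝ) →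
      (degA A y : ℝ) / 2 ≤ ({z | AdjPA A r y z ∧ (degA A z : ℝ) < X}.ncard : ℝ))
    {x p : Fin N} (hx : X ≤ (degA A x : ℝ)) (hp : x ∈ S1pmA A r p) :
    (degA A p : ℝ) / 2 ≤ (SibmA A r x).ncard ∧ (degA A x : ℝ) ≤ degA A p := by
  have hxp : (degA A x : ℝ) ≤ degA A p := by
    have := hp.2
    unfold precA at this
    exact_mod_cast (by omega : degA A x ≤ degA A p)
  refine ⟨(hH p (hx.trans hxp)).trans ?_, hxp⟩
  norm_cast
  refine Set.ncard_le_ncard ?_ (Set.toFinite _)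
  rintro z ⟨hz, hzX⟩
  rw [Sibm_eq hs hp]
  refine ⟨⟨hz, Or.inl ?_⟩, Or.inl ?_⟩
  · exact_mod_cast hzX.trans_le (hx.trans hxp)
  · exact_mod_cast hzX.trans_le hx

end det
end GRG

namespace GRG
variable {N : ℕ}
section linalg
open Classical
variable (A : Fin N → Fin N → Prop) (r : ℕ) (X : ℝ)

/-- indicator of the high set -/
noncomputable def hi (x : Fin N) : ℝ := if X ≤ (degA A x : ℝ) then 1 else 0

/-- child relation indicator -/
noncomputable def ch (x y : Fin N) : ℝ := if y ∈ S1pmA A r x then 1 else 0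

noncomputable def aV (x y : Fin N) : ℝ :=
  indVec {x} y - indVec (SibmA A r x) y / (SibmA A r x).ncard

noncomputable def cC (x : Fin N) : ℝ := 2 / ZxA A r x

noncomputable def Hm : Matrix (Fin N) (Fin N) ℝ := fun x y => hi A X x * ch A r x y
noncomputable def Lm : Matrix (Fin N) (Fin N) ℝ := fun x y => (1 - hi A X x) * ch A r x y
noncomputable def Km : Matrix (Fin N) (Fin N) ℝ := fun x y => hi A X x * aV A r x y
noncomputable def Km' : Matrix (Fin N) (Fin N) ℝ := fun x y => cC A r x * (hi A X x * aV A r x y)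
noncomputable def Qm : Matrix (Fin N) (Fin N) ℝ := fun y z =>
  ∑ x, hi A X x * cC A r x * (degPmA A r x : ℝ)⁻¹ * (ch A r x y * ch A r x z)

variable {A r X}

lemma hi_nonneg (x : Fin N) : 0 ≤ hi A X x := by unfold hi; split_ifs <;> norm_num
lemma hi_le (x : Fin N) : hi A X x ≤ 1 := by unfold hi; split_ifs <;> norm_num
lemma ch_nonneg (x y : Fin N) : 0 ≤ ch A r x y := by unfold ch; split_ifs <;> norm_num
lemma ZxA_ge (x : Fin N) : 2 ≤ ZxA A r x := by
  unfold ZxA; have : (0:ℝ) ≤ 2 / (SibmA A r x).ncard := by positivity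
  linarith
lemma cC_nonneg (x : Fin N) : 0 ≤ cC A r x := by
  unfold cC; have := ZxA_ge (A := A) (r := r) x; positivity
lemma cC_le (x : Fin N) : cC A r x ≤ 1 := by
  unfold cC; have := ZxA_ge (A := A) (r := r) x
  rw [div_le_one (by linarith)]; exact this

lemma hi_mul_self (x : Fin N) : hi A X x * hi A X x = hi A X x := by
  unfold hi; split_ifs <;> norm_num
lemma ch_mul_self (x y : Fin N) : ch A r x y * ch A r x y = ch A r x y := by
  unfold ch; split_ifs <;> norm_num

lemma adj_decomp (hs : ∀ x y, A x y → A y x) (hi' : ∀ x, ¬ A x x) :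
    adjMatrixPA A r = Lm A r X + (Lm A r X).transpose + Hm A r X + (Hm A r X).transpose := by
  ext x y
  simp only [adjMatrixPA, Matrix.add_apply, Matrix.transpose_apply, Lm, Hm]
  have : (if AdjPA A r x y then (1:ℝ) else 0) = ch A r x y + ch A r y x := by
    unfold ch
    by_cases h : AdjPA A r x y
    · have hne : x ≠ y := by rintro rfl; exact hi' _ h.1.1
      have h' := h.symm hs
      rcases precA_trich (A := A) hne with hp | hp
      · have hn := precA_asymm hp
        simp [S1pmA, h, h', hp, hn]
      · have hn := precA_asymm hp
        simp [S1pmA, h, h', hp, hn]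
    · have h' : ¬ AdjPA A r y x := fun h' => h (h'.symm hs)
      simp [S1pmA, h, h']
  rw [this]; ring

lemma indVec_apply (S : Set (Fin N)) (y : Fin N) : indVec S y = if y ∈ S then 1 else 0 := by
  simp [indVec, Set.indicator]

lemma sum_indVec (S : Set (Fin N)) : ∑ y, indVec S y = (S.ncard : ℝ) := by
  simp only [indVec_apply]
  rw [Finset.sum_ite, Finset.sum_const_zero, add_zero, Finset.sum_const, nsmul_eq_mul, mul_one,
    Set.ncard_eq_toFinset_card']
  congr 2
  ext; simp

lemma sum_ch (x : Fin N) : ∑ y, ch A r x y = (degPmA A r x : ℝ) := by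
  have : ∀ y, ch A r x y = indVec (S1pmA A r x) y := fun y => by rw [indVec_apply]; rfl
  simp only [this, sum_indVec]; rfl

lemma ch_eq_zero_or (hs : ∀ x y, A x y → A y x) (y : Fin N) :
    (∀ x, ch A r x y = 0) ∨ ∃ p, y ∈ S1pmA A r p ∧ ∀ x, ch A r x y = if x = p then 1 else 0 := by
  by_cases h : ∃ p, y ∈ S1pmA A r p
  · obtain ⟨p, hp⟩ := h
    refine Or.inr ⟨p, hp, fun x => ?_⟩
    unfold ch
    by_cases hx : x = p
    · subst hx; simp [hp]
    · rw [if_neg hx, if_neg]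
      exact fun h => hx (parent_unique hs h hp)
  · push Not at h
    left; intro x; simp [ch, h x]

lemma sum_ch_left (hs : ∀ x y, A x y → A y x) (y : Fin N) : ∑ x, ch A r x y ≤ 1 := by
  rcases ch_eq_zero_or (r := r) hs y with h | ⟨p, -, h⟩
  · simp [h]
  · simp [h]

lemma PiPA_eq {ν δ : ℝ} (hX : X = xi ν δ N) :
    PiPA A r ν δ = (Km A r X).transpose * Km' A r X + Qm A r X := by
  ext y z
  simp only [PiPA, Matrix.sum_apply, Matrix.smul_apply, Matrix.add_apply, Matrix.mul_apply,
    Matrix.transpose_apply, Km, Km', Qm]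
  rw [← Finset.sum_add_distrib]
  refine Finset.sum_congr rfl fun x _ => ?_
  have h1 : Set.indicator (VhA A ν δ) (fun _ => (1 : ℝ)) x = hi A X x := by
    unfold hi
    by_cases h : X ≤ (degA A x : ℝ)
    · rw [if_pos h, Set.indicator_of_mem (show x ∈ VhA A ν δ by rw [hX] at h; exact h)]
    · rw [if_neg h, Set.indicator_of_notMem (show x ∉ VhA A ν δ by rw [hX] at h; exact h)]
  have hZ := ZxA_ge (A := A) (r := r) x
  have h2 : (√(ZxA A r x))⁻¹ ^ 2 = (ZxA A r x)⁻¹ := by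
    rw [inv_pow, Real.sq_sqrt (by linarith)]
  have h3 : (√(degPmA A r x : ℝ))⁻¹ ^ 2 = (degPmA A r x : ℝ)⁻¹ := by
    rw [inv_pow, Real.sq_sqrt (by positivity)]
  have h4 : ∀ y, ch A r x y = indVec (S1pmA A r x) y := fun y => by rw [indVec_apply]; rfl
  rw [h1, h4, h4]
  simp only [Matrix.vecMulVec_apply, uVecA, aV, cC, smul_eq_mul, div_eq_mul_inv (2:ℝ)]
  rw [← h2, ← h3]
  have h5 := hi_mul_self (A := A) (X := X) x
  rw [show ∀ a b c d : ℝ, a * b * (c * (a * d)) = (a * a) * (b * c * d) by intros; ring, h5]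
  ring

variable (hs : ∀ x y, A x y → A y x) (hX1 : 1 ≤ X)
    (hH : ∀ y, X ≤ (degA A y : ℝ) →
      (degA A y : ℝ) / 2 ≤ ({z | AdjPA A r y z ∧ (degA A z : ℝ) < X}.ncard : ℝ))
include hs hX1 hH

omit hs hX1 hH in
lemma Km_row (x : Fin N) : ∑ y, |Km A r X x y| ≤ 2 := by
  have : ∀ y, |Km A r X x y| ≤ indVec {x} y + indVec (SibmA A r x) y / (SibmA A r x).ncard := by
    intro y
    unfold Km aV
    have h1 : 0 ≤ indVec {x} y := by rw [indVec_apply]; split_ifs <;> norm_num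
    have h2 : 0 ≤ indVec (SibmA A r x) y / (SibmA A r x).ncard := by
      rw [indVec_apply]; split_ifs <;> positivity
    have h3 := hi_nonneg (A := A) (X := X) x
    have h4 := hi_le (A := A) (X := X) x
    rw [abs_mul, abs_of_nonneg h3]
    calc _ ≤ 1 * |indVec {x} y - indVec (SibmA A r x) y / (SibmA A r x).ncard| :=
          mul_le_mul_of_nonneg_right h4 (abs_nonneg _)
      _ ≤ _ := by
          rw [one_mul, abs_le]; constructor <;> linarith
  refine (Finset.sum_le_sum fun y _ => this y).trans ?_
  rw [Finset.sum_add_distrib, ← Finset.sum_div, sum_indVec, sum_indVec]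
  have : ((SibmA A r x).ncard : ℝ) / (SibmA A r x).ncard ≤ 1 := div_self_le_one _
  simp only [Set.ncard_singleton]; push_cast; linarith

lemma Km_col (y : Fin N) : ∑ x, |Km A r X x y| ≤ 3 := by
  have key : ∃ p : Fin N, ∀ x, |Km A r X x y| ≤ (if x = y then 1 else 0)
      + 2 * (ch A r p x * (degA A p : ℝ)⁻¹) := by
    by_cases hp : ∃ p, y ∈ S1pmA A r p
    · obtain ⟨p, hp⟩ := hp
      refine ⟨p, fun x => ?_⟩
      have h1 : 0 ≤ indVec {x} y := by rw [indVec_apply]; split_ifs <;> norm_num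
      have h1' : indVec {x} y ≤ if x = y then 1 else 0 := by
        rw [indVec_apply]; simp [eq_comm]
      have h2 : 0 ≤ indVec (SibmA A r x) y / (SibmA A r x).ncard := by
        rw [indVec_apply]; split_ifs <;> positivity
      have hch := ch_nonneg (A := A) (r := r) p x
      have hd : 0 ≤ ch A r p x * (degA A p : ℝ)⁻¹ := by positivity
      unfold Km aV hi
      generalize (if x = y then (1:ℝ) else 0) = d at h1' ⊢
      by_cases hx : X ≤ (degA A x : ℝ)
      · rw [if_pos hx, one_mul]
        by_cases hy : y ∈ SibmA A r x
        · obtain ⟨q, e1, e2, e3, e4, e5⟩ := hy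
          have : p = q := parent_unique hs hp ⟨e3, e4⟩
          subst this
          have hxp : x ∈ S1pmA A r p := ⟨e1.symm hs, e2⟩
          obtain ⟨f1, f2⟩ := Sib_large hs hH hx hxp
          have hdp : (0:ℝ) < degA A p := by linarith
          have : ch A r p x = 1 := by simp [ch, hxp]
          rw [this, one_mul]
          have h3 : indVec (SibmA A r x) y / (SibmA A r x).ncard ≤ 2 * (degA A p : ℝ)⁻¹ := by
            have : indVec (SibmA A r x) y ≤ 1 := by rw [indVec_apply]; split_ifs <;> norm_num
            rw [← div_eq_mul_inv, div_le_div_iff₀ (by linarith) hdp]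
            nlinarith
          rw [abs_le]; constructor <;> linarith
        · have : indVec (SibmA A r x) y = 0 := by rw [indVec_apply]; simp [hy]
          rw [this, zero_div, sub_zero, abs_of_nonneg h1]
          linarith
      · rw [if_neg hx, zero_mul, abs_zero]; linarith
    · push Not at hp
      refine ⟨y, fun x => ?_⟩
      have h1 : 0 ≤ indVec {x} y := by rw [indVec_apply]; split_ifs <;> norm_num
      have h1' : indVec {x} y ≤ if x = y then 1 else 0 := by
        rw [indVec_apply]; simp [eq_comm]
      have : indVec (SibmA A r x) y = 0 := by
        rw [indVec_apply, if_neg]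
        rintro ⟨q, e1, e2, e3, e4, e5⟩
        exact hp q ⟨e3, e4⟩
      have hch := ch_nonneg (A := A) (r := r) y x
      have hd : 0 ≤ ch A r y x * (degA A y : ℝ)⁻¹ := by positivity
      have h3 := hi_nonneg (A := A) (X := X) x
      have h4 := hi_le (A := A) (X := X) x
      unfold Km aV
      rw [this, zero_div, sub_zero, abs_of_nonneg (by positivity)]
      nlinarith
  obtain ⟨p, hp⟩ := key
  refine (Finset.sum_le_sum fun x _ => hp x).trans ?_
  rw [Finset.sum_add_distrib, ← Finset.mul_sum, ← Finset.sum_mul, sum_ch]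
  have h1 : (degPmA A r p : ℝ) ≤ degA A p := by exact_mod_cast degPmA_le p
  have h2 : (degPmA A r p : ℝ) * (degA A p : ℝ)⁻¹ ≤ 1 :=
    (mul_le_mul_of_nonneg_right h1 (by positivity)).trans (mul_inv_le_one)
  simp only [Finset.sum_ite_eq', Finset.mem_univ, if_true]
  linarith

lemma opNorm_Km : opNorm (Km A r X) ≤ √6 := by
  have := opNorm_schur (Km A r X) 2 3 (by norm_num) (by norm_num) (Km_row)
    (Km_col hs hX1 hH)
  norm_num at this; exact this

lemma opNorm_Km' : opNorm (Km' A r X) ≤ √6 := by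
  have h : ∀ x y, |Km' A r X x y| ≤ |Km A r X x y| := by
    intro x y
    have e : Km' A r X x y = cC A r x * Km A r X x y := rfl
    rw [e, abs_mul, abs_of_nonneg (cC_nonneg x)]
    exact mul_le_of_le_one_left (abs_nonneg _) (cC_le x)
  have := opNorm_schur (Km' A r X) 2 3 (by norm_num) (by norm_num)
    (fun x => (Finset.sum_le_sum fun y _ => h x y).trans (Km_row x))
    (fun y => (Finset.sum_le_sum fun x _ => h x y).trans (Km_col hs hX1 hH y))
  norm_num at this; exact this

omit hX1 hH in
lemma opNorm_Qm : opNorm (Qm A r X) ≤ 1 := by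
  have hnn : ∀ y z, 0 ≤ Qm A r X y z := fun y z => Finset.sum_nonneg fun x _ => by
    have h1 := hi_nonneg (A := A) (X := X) x
    have h2 := cC_nonneg (A := A) (r := r) x
    have h3 := ch_nonneg (A := A) (r := r) x
    have := h3 y; have := h3 z
    positivity
  have hsym : ∀ y z, Qm A r X y z = Qm A r X z y := fun y z =>
    Finset.sum_congr rfl fun x _ => by ring
  have hrow : ∀ y, ∑ z, |Qm A r X y z| ≤ 1 := by
    intro y
    simp only [abs_of_nonneg (hnn _ _)]
    unfold Qm
    rw [Finset.sum_comm]
    calc _ ≤ ∑ x, ch A r x y := by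
          refine Finset.sum_le_sum fun x _ => ?_
          have h1 := hi_nonneg (A := A) (X := X) x
          have h1' := hi_le (A := A) (X := X) x
          have h2 := cC_nonneg (A := A) (r := r) x
          have h2' := cC_le (A := A) (r := r) x
          have h3 := ch_nonneg (A := A) (r := r) x y
          rw [← Finset.mul_sum, ← Finset.mul_sum, sum_ch]
          have h4 : (degPmA A r x : ℝ)⁻¹ * degPmA A r x ≤ 1 := by
            rw [mul_comm]; exact mul_inv_le_one
          have h5 : 0 ≤ (degPmA A r x : ℝ)⁻¹ * degPmA A r x := by positivity
          calc _ = (hi A X x * cC A r x * ((degPmA A r x : ℝ)⁻¹ * degPmA A r x)) * ch A r x y := by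
                ring
            _ ≤ 1 * ch A r x y := by
                apply mul_le_mul_of_nonneg_right _ h3
                exact mul_le_one₀ (mul_le_one₀ h1' h2 h2') h5 h4
            _ = _ := one_mul _
      _ ≤ 1 := sum_ch_left hs y
  have := opNorm_schur (Qm A r X) 1 1 (by norm_num) (by norm_num) hrow
    (fun y => by simp only [fun x => hsym x y]; exact hrow y)
  simpa using this

omit hH in
lemma opNorm_Lm : opNorm (Lm A r X) ≤ √X := by
  have h0 : ∀ x y, |Lm A r X x y| ≤ ch A r x y := by
    intro x y
    have h1 := hi_nonneg (A := A) (X := X) x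
    have h1' := hi_le (A := A) (X := X) x
    have h3 := ch_nonneg (A := A) (r := r) x y
    unfold Lm
    rw [abs_mul, abs_of_nonneg h3, abs_of_nonneg (by linarith)]
    exact mul_le_of_le_one_left h3 (by linarith)
  have := opNorm_schur (Lm A r X) X 1 (by linarith) (by norm_num) ?_ ?_
  · simpa using this
  · intro x
    by_cases hx : X ≤ (degA A x : ℝ)
    · have : ∀ y, Lm A r X x y = 0 := fun y => by simp [Lm, hi, hx]
      simp only [this, abs_zero, Finset.sum_const_zero]; linarith
    · push Not at hx
      refine (Finset.sum_le_sum fun y _ => h0 x y).trans ?_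
      rw [sum_ch]
      have h1 : (degPmA A r x : ℝ) ≤ degA A x := by exact_mod_cast degPmA_le x
      linarith
  · intro y
    exact (Finset.sum_le_sum fun x _ => h0 x y).trans (sum_ch_left hs y)

lemma Hm_mul_Km : Hm A r X * (Km A r X).transpose = 0 := by
  ext y x
  simp only [Matrix.mul_apply, Matrix.transpose_apply, Hm, Km, Matrix.zero_apply]
  by_cases hx : X ≤ (degA A x : ℝ)
  · have : ∑ z, ch A r y z * aV A r x z = 0 := by
      have e1 : ∀ z, ch A r y z * aV A r x z = (if z = x then ch A r y z else 0)
          - (ch A r y z * indVec (SibmA A r x) z) / (SibmA A r x).ncard := by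
        intro z
        have : indVec {x} z = if z = x then 1 else 0 := by rw [indVec_apply]; simp
        unfold aV; rw [this]; split_ifs <;> ring
      simp only [e1]
      rw [Finset.sum_sub_distrib, ← Finset.sum_div]
      simp only [Finset.sum_ite_eq', Finset.mem_univ, if_true]
      by_cases hp : ∃ p, x ∈ S1pmA A r p
      · obtain ⟨p, hp⟩ := hp
        obtain ⟨f1, f2⟩ := Sib_large hs hH hx hp
        have hpos : (0:ℝ) < (SibmA A r x).ncard := by linarith
        by_cases hyp : y = p
        · subst hyp
          have : ∀ z, ch A r y z * indVec (SibmA A r x) z = indVec (SibmA A r x) z := by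
            intro z
            rw [indVec_apply]
            split_ifs with h
            · rw [Sibm_eq hs hp] at h
              simp [ch, h.1]
            · simp
          simp only [this]
          rw [sum_indVec, div_self hpos.ne']
          simp [ch, hp]
        · have : ∀ z, ch A r y z * indVec (SibmA A r x) z = 0 := by
            intro z
            rw [indVec_apply]
            split_ifs with h
            · rw [Sibm_eq hs hp] at h
              have : z ∉ S1pmA A r y := fun h' => hyp (parent_unique hs h' h.1)
              simp [ch, this]
            · simp
          have h2 : x ∉ S1pmA A r y := fun h' => hyp (parent_unique hs h' hp)
          have h3 : ch A r y x = 0 := by simp [ch, h2]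
          simp [this, h3]
      · push Not at hp
        rw [Sibm_eq_empty hs hp]
        simp [ch, hp y]
    have e : ∀ z, hi A X y * ch A r y z * (hi A X x * aV A r x z)
      = (hi A X y * hi A X x) * (ch A r y z * aV A r x z) := fun z => by ring
    simp only [e]
    rw [← Finset.mul_sum, this, mul_zero]
  · have : hi A X x = 0 := by simp [hi, hx]
    simp [this]

omit hX1 hH in
lemma Hm_mul_Qm (x y : Fin N) : (Hm A r X * Qm A r X) x y = cC A r x * Hm A r X x y := by
  have orth : ∀ x', ∑ z, ch A r x z * ch A r x' z = if x' = x then (degPmA A r x : ℝ) else 0 := by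
    intro x'
    split_ifs with h
    · subst h; simp only [ch_mul_self, sum_ch]
    · refine Finset.sum_eq_zero fun z _ => ?_
      unfold ch
      split_ifs with h1 h2 <;> try simp
      exact h (parent_unique hs h2 h1)
  simp only [Matrix.mul_apply, Hm, Qm, Finset.mul_sum]
  rw [Finset.sum_comm]
  have e : ∀ x' z, hi A X x * ch A r x z * (hi A X x' * cC A r x' * (degPmA A r x' : ℝ)⁻¹ *
      (ch A r x' z * ch A r x' y)) = (hi A X x * hi A X x' * cC A r x' * (degPmA A r x' : ℝ)⁻¹ *
      ch A r x' y) * (ch A r x z * ch A r x' z) := by intros; ring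
  simp only [e]
  simp only [← Finset.mul_sum, orth]
  simp only [mul_ite, mul_zero, Finset.sum_ite_eq', Finset.mem_univ, if_true]
  rw [hi_mul_self]
  by_cases hc : ch A r x y = 0
  · simp [hc]
  · have : (degPmA A r x : ℝ) ≠ 0 := by
      have h1 : y ∈ S1pmA A r x := by by_contra h; exact hc (by simp [ch, h])
      have : 0 < (S1pmA A r x).ncard := (Set.ncard_pos (Set.toFinite _)).2 ⟨y, h1⟩
      exact_mod_cast this.ne'
    field_simp

lemma opNorm_HP {ν δ : ℝ} (hX : X = xi ν δ N) :
    opNorm (Hm A r X * (1 - PiPA A r ν δ)) ≤ √2 := by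
  have e : ∀ x y, (Hm A r X * (1 - PiPA A r ν δ)) x y = (1 - cC A r x) * Hm A r X x y := by
    intro x y
    rw [PiPA_eq hX, mul_sub, mul_one, mul_add, ← mul_assoc, Hm_mul_Km hs hX1 hH, zero_mul, zero_add,
      Matrix.sub_apply, Hm_mul_Qm hs]
    ring
  have hh : ∀ x y, 0 ≤ Hm A r X x y := fun x y => mul_nonneg (hi_nonneg x) (ch_nonneg x y)
  have hnn : ∀ x y, 0 ≤ (1 - cC A r x) * Hm A r X x y := fun x y =>
    mul_nonneg (by linarith [cC_le (A := A) (r := r) x]) (hh x y)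
  have := opNorm_schur (Hm A r X * (1 - PiPA A r ν δ)) 2 1 (by norm_num) (by norm_num) ?_ ?_
  · simpa using this
  · intro x
    simp only [e, abs_of_nonneg (hnn _ _)]
    rw [← Finset.mul_sum]
    unfold Hm
    rw [← Finset.mul_sum, sum_ch]
    unfold hi
    split_ifs with hx
    · rw [one_mul]
      by_cases hp : ∃ p, x ∈ S1pmA A r p
      · obtain ⟨p, hp⟩ := hp
        obtain ⟨f1, f2⟩ := Sib_large hs hH hx hp
        have h1 : (degPmA A r x : ℝ) ≤ degA A x := by exact_mod_cast degPmA_le x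
        have hpos : (0:ℝ) < (SibmA A r x).ncard := by linarith
        have : 1 - cC A r x = 1 / (1 + (SibmA A r x).ncard) := by
          unfold cC ZxA; field_simp; ring
        rw [this, one_div, inv_mul_le_iff₀ (by linarith)]
        linarith
      · push Not at hp
        have : cC A r x = 1 := by
          unfold cC ZxA; rw [Sibm_eq_empty hs hp]; simp
        rw [this]; simp
    · simp
  · intro y
    simp only [e, abs_of_nonneg (hnn _ _)]
    refine (Finset.sum_le_sum fun x _ => ?_).trans (sum_ch_left (r := r) hs y)
    have h1 := cC_nonneg (A := A) (r := r) x
    have h2 := cC_le (A := A) (r := r) x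
    have h3 := hi_nonneg (A := A) (X := X) x
    have h4 := hi_le (A := A) (X := X) x
    have h5 := ch_nonneg (A := A) (r := r) x y
    unfold Hm
    rw [← mul_assoc]
    exact mul_le_of_le_one_left h5 (mul_le_one₀ (by linarith) h3 h4)

theorem det_bound {ν δ : ℝ} (hi' : ∀ x, ¬ A x x) (hX : X = xi ν δ N) :
    opNorm ((1 - PiPA A r ν δ) * adjMatrixPA A r * (1 - PiPA A r ν δ)) ≤ 160 * √X := by
  have hPi : opNorm (PiPA A r ν δ) ≤ 7 := by
    rw [PiPA_eq hX]
    refine (opNorm_add_le _ _).trans ?_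
    have h1 := opNorm_mul_le (Km A r X).transpose (Km' A r X)
    rw [opNorm_transpose] at h1
    have h2 : opNorm (Km A r X) * opNorm (Km' A r X) ≤ √6 * √6 :=
      mul_le_mul (opNorm_Km hs hX1 hH) (opNorm_Km' hs hX1 hH) (opNorm_nonneg _) (by positivity)
    rw [Real.mul_self_sqrt (by norm_num)] at h2
    linarith [opNorm_Qm (r := r) (X := X) hs]
  have hsymPi : (PiPA A r ν δ).transpose = PiPA A r ν δ := by
    ext x y
    simp only [PiPA, Matrix.transpose_apply, Matrix.sum_apply, Matrix.smul_apply, Matrix.add_apply,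
      Matrix.vecMulVec_apply]
    refine Finset.sum_congr rfl fun z _ => ?_
    congr 1; ring
  set P := 1 - PiPA A r ν δ with hP
  have hPT : P.transpose = P := by
    rw [hP, Matrix.transpose_sub, hsymPi, Matrix.transpose_one]
  have hPn : opNorm P ≤ 8 := by
    have := opNorm_sub_le (1 : Matrix (Fin N) (Fin N) ℝ) (PiPA A r ν δ)
    linarith [opNorm_one_le (N := N)]
  have hPn0 := opNorm_nonneg P
  rw [adj_decomp (r := r) (X := X) hs hi']
  set L := Lm A r X
  set H := Hm A r X
  have e : P * (L + L.transpose + H + H.transpose) * P =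
    P * (L + L.transpose) * P + (P * (H * P) + (H * P).transpose * P) := by
    rw [Matrix.transpose_mul, hPT]; noncomm_ring
  rw [e]
  have hL : opNorm L ≤ √X := opNorm_Lm hs hX1
  have hHP : opNorm (H * P) ≤ √2 := opNorm_HP hs hX1 hH hX
  have hLL : opNorm (L + L.transpose) ≤ 2 * √X := by
    refine (opNorm_add_le _ _).trans ?_
    rw [opNorm_transpose]; linarith
  have h1 : opNorm (P * (L + L.transpose) * P) ≤ 8 * (2 * √X) * 8 := by
    refine (opNorm_mul_le _ _).trans ?_
    refine mul_le_mul ((opNorm_mul_le _ _).trans ?_) hPn hPn0 (by positivity)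
    exact mul_le_mul hPn hLL (opNorm_nonneg _) (by norm_num)
  have h2 : opNorm (P * (H * P)) ≤ 8 * √2 :=
    (opNorm_mul_le _ _).trans (mul_le_mul hPn hHP (opNorm_nonneg _) (by norm_num))
  have h3 : opNorm ((H * P).transpose * P) ≤ √2 * 8 := by
    refine (opNorm_mul_le _ _).trans ?_
    rw [opNorm_transpose]
    exact mul_le_mul hHP hPn hPn0 (by positivity)
  have h4 : √2 ≤ 2 := by rw [Real.sqrt_le_left (by norm_num)]; norm_num
  have h5 : 1 ≤ √X := by rw [Real.one_le_sqrt]; exact hX1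
  have := opNorm_add_le (P * (L + L.transpose) * P) (P * (H * P) + (H * P).transpose * P)
  have := opNorm_add_le (P * (H * P)) ((H * P).transpose * P)
  nlinarith

end linalg
end GRG

namespace GRG
variable {N : ℕ}
section prob
open Classical

lemma pGRG_symm (w : Fin N → ℝ) (x y : Fin N) : pGRG w x y = pGRG w y x := by
  unfold pGRG; rw [mul_comm (w x)]

/-- edge probability of an unordered pair -/
noncomputable def pS (w : Fin N → ℝ) : Sym2 (Fin N) → ℝ :=
  Sym2.lift ⟨pGRG w, pGRG_symm w⟩

lemma pS_mk (w : Fin N → ℝ) (x y : Fin N) : pS w s(x, y) = pGRG w x y := rfl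

/-- the unordered pair of an edge index -/
def toS (e : EdgeIdx N) : Sym2 (Fin N) := s(e.val.1, e.val.2)

lemma toS_inj : Function.Injective (toS (N := N)) := by
  rintro ⟨⟨a, b⟩, h⟩ ⟨⟨c, d⟩, h'⟩ e
  simp only [toS, Sym2.eq_iff] at e
  simp only at h h'
  rcases e with ⟨rfl, rfl⟩ | ⟨rfl, rfl⟩
  · rfl
  · exact absurd h (not_lt.2 h'.le)

lemma exists_toS {s : Sym2 (Fin N)} (hs : ¬ s.IsDiag) : ∃ e, toS e = s := by
  induction s with
  | _ x y =>
    have hne : x ≠ y := by simpa using hs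
    rcases lt_or_gt_of_ne hne with h | h
    · exact ⟨⟨(x, y), h⟩, rfl⟩
    · exact ⟨⟨(y, x), h⟩, Sym2.eq_swap⟩

/-- presence of an unordered pair -/
def pres (ω : EdgeIdx N → Bool) (s : Sym2 (Fin N)) : Prop := ∃ e, toS e = s ∧ ω e = true

lemma pres_toS (ω : EdgeIdx N → Bool) (e : EdgeIdx N) : pres ω (toS e) ↔ ω e = true := by
  constructor
  · rintro ⟨e', h, h'⟩; rwa [← toS_inj h]
  · exact fun h => ⟨e, rfl, h⟩

lemma pres_not_diag {ω : EdgeIdx N → Bool} {s : Sym2 (Fin N)} (h : pres ω s) : ¬ s.IsDiag := by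
  obtain ⟨⟨⟨a, b⟩, hlt⟩, rfl, -⟩ := h
  simp only [toS, Sym2.mk_isDiag_iff]
  exact ne_of_lt hlt

lemma Adj_iff (ω : EdgeIdx N → Bool) (x y : Fin N) : Adj ω x y ↔ pres ω s(x, y) := by
  unfold Adj adjMatrix
  rcases lt_trichotomy x y with h | h | h
  · rw [dif_pos h]
    rw [show s(x, y) = toS ⟨(x, y), h⟩ from rfl, pres_toS]
    split_ifs with h' <;> simp [h']
  · subst h
    simp only [lt_self_iff_false, dite_false, zero_ne_one, false_iff]
    exact fun h => pres_not_diag h (by simp)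
  · rw [dif_neg (not_lt.2 h.le), dif_pos h]
    rw [show s(x, y) = toS ⟨(y, x), h⟩ from Sym2.eq_swap, pres_toS]
    split_ifs with h' <;> simp [h']

lemma Adj_symm (ω : EdgeIdx N → Bool) (x y : Fin N) (h : Adj ω x y) : Adj ω y x := by
  rw [Adj_iff] at *; rwa [Sym2.eq_swap]

lemma Adj_irrefl (ω : EdgeIdx N → Bool) (x : Fin N) : ¬ Adj ω x x := by
  rw [Adj_iff]; exact fun h => pres_not_diag h (by simp)

/-- weight of a configuration -/
noncomputable def wt (w : Fin N → ℝ) (ω : EdgeIdx N → Bool) : ℝ :=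
  ∏ e, if ω e = true then pS w (toS e) else 1 - pS w (toS e)

/-- expectation -/
noncomputable def Ex (w : Fin N → ℝ) (f : (EdgeIdx N → Bool) → ℝ) : ℝ := ∑ ω, wt w ω * f ω

/-- probability -/
noncomputable def Pr (w : Fin N → ℝ) (E : (EdgeIdx N → Bool) → Prop) : ℝ :=
  Ex w (fun ω => if E ω then 1 else 0)

variable {w : Fin N → ℝ}

lemma S_pos (hw : ∀ x, 0 < w x) (x : Fin N) : 0 < ∑ z, w z :=
  Finset.sum_pos (fun z _ => hw z) ⟨x, Finset.mem_univ x⟩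

lemma pGRG_nonneg (hw : ∀ x, 0 < w x) (x y : Fin N) : 0 ≤ pGRG w x y := by
  have := S_pos hw x; have := hw x; have := hw y
  unfold pGRG; positivity

lemma pGRG_le_one (hw : ∀ x, 0 < w x) (x y : Fin N) : pGRG w x y ≤ 1 := by
  have h1 := S_pos hw x; have := hw x; have := hw y
  have h2 : 0 < w x * w y := by positivity
  unfold pGRG; rw [div_le_one (by positivity)]; linarith

lemma pGRG_le (hw : ∀ x, 0 < w x) (x y : Fin N) : pGRG w x y ≤ w x * w y / ∑ z, w z := by
  have h1 := S_pos hw x; have := hw x; have := hw y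
  have h2 : 0 < w x * w y := by positivity
  unfold pGRG
  apply div_le_div_of_nonneg_left h2.le h1; linarith

lemma pS_nonneg (hw : ∀ x, 0 < w x) (s : Sym2 (Fin N)) : 0 ≤ pS w s := by
  induction s with | _ x y => exact pGRG_nonneg hw x y

lemma pS_le_one (hw : ∀ x, 0 < w x) (s : Sym2 (Fin N)) : pS w s ≤ 1 := by
  induction s with | _ x y => exact pGRG_le_one hw x y

lemma wt_nonneg (hw : ∀ x, 0 < w x) (ω : EdgeIdx N → Bool) : 0 ≤ wt w ω := by
  unfold wt
  refine Finset.prod_nonneg fun e _ => ?_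
  split_ifs
  · exact pS_nonneg hw _
  · linarith [pS_le_one hw (toS e)]

lemma Ex_mono (hw : ∀ x, 0 < w x) {f g : (EdgeIdx N → Bool) → ℝ} (h : ∀ ω, f ω ≤ g ω) :
    Ex w f ≤ Ex w g :=
  Finset.sum_le_sum fun ω _ => mul_le_mul_of_nonneg_left (h ω) (wt_nonneg hw ω)

lemma Ex_sum {ι : Type*} (I : Finset ι) (f : ι → (EdgeIdx N → Bool) → ℝ) :
    Ex w (fun ω => ∑ i ∈ I, f i ω) = ∑ i ∈ I, Ex w (f i) := by
  unfold Ex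
  simp_rw [Finset.mul_sum]
  rw [Finset.sum_comm]

lemma Ex_const_mul (c : ℝ) (f : (EdgeIdx N → Bool) → ℝ) :
    Ex w (fun ω => c * f ω) = c * Ex w f := by
  unfold Ex
  rw [Finset.mul_sum]
  exact Finset.sum_congr rfl fun _ _ => by ring

lemma Ex_prod_univ (h : EdgeIdx N → Bool → ℝ) :
    Ex w (fun ω => ∏ e, h e (ω e)) =
      ∏ e, (pS w (toS e) * h e true + (1 - pS w (toS e)) * h e false) := by
  unfold Ex wt
  simp_rw [← Finset.prod_mul_distrib]
  have := Finset.prod_univ_sum (fun _ : EdgeIdx N => (Finset.univ : Finset Bool))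
    (fun e b => (if b = true then pS w (toS e) else 1 - pS w (toS e)) * h e b)
  rw [Fintype.piFinset_univ] at this
  rw [← this]
  refine Finset.prod_congr rfl fun e _ => ?_
  simp

lemma Ex_prod_sym (F : Finset (Sym2 (Fin N))) (hF : ∀ s ∈ F, ¬ s.IsDiag) (α β : Sym2 (Fin N) → ℝ) :
    Ex w (fun ω => ∏ s ∈ F, if pres ω s then α s else β s) =
      ∏ s ∈ F, (pS w s * α s + (1 - pS w s) * β s) := by
  have hFi : F = (Finset.univ.filter fun e => toS e ∈ F).image toS := by
    ext s
    simp only [Finset.mem_image, Finset.mem_filter, Finset.mem_univ, true_and]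
    constructor
    · intro h
      obtain ⟨e, rfl⟩ := exists_toS (hF s h)
      exact ⟨e, h, rfl⟩
    · rintro ⟨e, h, rfl⟩; exact h
  have e1 : ∀ g : Sym2 (Fin N) → ℝ, ∏ s ∈ F, g s = ∏ e, if toS e ∈ F then g (toS e) else 1 := by
    intro g
    conv_lhs => rw [hFi]
    rw [Finset.prod_image (fun a _ b _ h => toS_inj h), Finset.prod_filter]
  simp_rw [e1]
  have := Ex_prod_univ (w := w) (fun e b => if toS e ∈ F then
    (if b = true then α (toS e) else β (toS e)) else 1)
  simp only [pres_toS]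
  rw [this]
  refine Finset.prod_congr rfl fun e _ => ?_
  by_cases h : toS e ∈ F <;> simp [h]

lemma Ex_one : Ex w (fun _ => 1) = 1 := by
  have := Ex_prod_sym (w := w) ∅ (by simp) (fun _ => 1) (fun _ => 1)
  simpa using this

lemma Pr_mono (hw : ∀ x, 0 < w x) {E E' : (EdgeIdx N → Bool) → Prop} (h : ∀ ω, E ω → E' ω) :
    Pr w E ≤ Pr w E' := by
  refine Ex_mono hw fun ω => ?_
  by_cases h1 : E ω
  · simp [h1, h ω h1]
  · simp only [h1, if_false]; split_ifs <;> norm_num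

lemma Pr_nonneg (hw : ∀ x, 0 < w x) (E : (EdgeIdx N → Bool) → Prop) : 0 ≤ Pr w E :=
  Finset.sum_nonneg fun ω _ => mul_nonneg (wt_nonneg hw ω) (by dsimp only; split_ifs <;> norm_num)

lemma Pr_union (hw : ∀ x, 0 < w x) {ι : Type*} (I : Finset ι) (E : (EdgeIdx N → Bool) → Prop)
    (E' : ι → (EdgeIdx N → Bool) → Prop) (h : ∀ ω, E ω → ∃ i ∈ I, E' i ω) :
    Pr w E ≤ ∑ i ∈ I, Pr w (E' i) := by
  unfold Pr
  rw [← Ex_sum]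
  refine Ex_mono hw fun ω => ?_
  by_cases h1 : E ω
  · obtain ⟨i, hi, hi'⟩ := h ω h1
    rw [if_pos h1]
    have := Finset.single_le_sum (f := fun i => if E' i ω then (1:ℝ) else 0)
      (fun i _ => by split_ifs <;> norm_num) hi
    simpa [hi'] using this
  · rw [if_neg h1]
    exact Finset.sum_nonneg fun i _ => by split_ifs <;> norm_num

lemma Pr_or (hw : ∀ x, 0 < w x) (E E' : (EdgeIdx N → Bool) → Prop) :
    Pr w (fun ω => E ω ∨ E' ω) ≤ Pr w E + Pr w E' := by
  have := Pr_union hw (Finset.univ : Finset Bool) (fun ω => E ω ∨ E' ω)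
    (fun b => if b then E else E') (fun ω h => by
      rcases h with h | h
      · exact ⟨true, by simp, by simpa using h⟩
      · exact ⟨false, by simp, by simpa using h⟩)
  simpa using this

lemma Pr_compl (E : (EdgeIdx N → Bool) → Prop) : Pr w E = 1 - Pr w (fun ω => ¬ E ω) := by
  have h : Pr w E + Pr w (fun ω => ¬ E ω) = 1 := by
    refine Eq.trans ?_ (Ex_one (w := w))
    unfold Pr Ex
    rw [← Finset.sum_add_distrib]
    refine Finset.sum_congr rfl fun ω _ => ?_
    by_cases h : E ω <;> simp [h]
  linarith

lemma Pr_markov (hw : ∀ x, 0 < w x) (E : (EdgeIdx N → Bool) → Prop) (f : (EdgeIdx N → Bool) → ℝ)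
    (c : ℝ) (hf : ∀ ω, 0 ≤ f ω) (h : ∀ ω, E ω → c ≤ f ω) : c * Pr w E ≤ Ex w f := by
  unfold Pr
  rw [← Ex_const_mul]
  refine Ex_mono hw fun ω => ?_
  by_cases h1 : E ω
  · simpa [h1] using h ω h1
  · simpa [h1] using hf ω

lemma Pr_pres_le (hw : ∀ x, 0 < w x) (F : Finset (Sym2 (Fin N))) :
    Pr w (fun ω => ∀ s ∈ F, pres ω s) ≤ ∏ s ∈ F, pS w s := by
  by_cases hF : ∀ s ∈ F, ¬ s.IsDiag
  · have := Ex_prod_sym (w := w) F hF (fun _ => 1) (fun _ => 0)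
    simp only [mul_one, mul_zero, add_zero] at this
    rw [← this]
    apply le_of_eq
    unfold Pr
    congr 1; ext ω
    rw [Finset.prod_ite_zero]; simp
  · push Not at hF
    obtain ⟨s, hs, hd⟩ := hF
    refine le_trans (le_of_eq ?_) (Finset.prod_nonneg fun s _ => pS_nonneg hw s)
    unfold Pr Ex
    refine Finset.sum_eq_zero fun ω _ => ?_
    have : ¬ ∀ s ∈ F, pres ω s := fun h => pres_not_diag (h s hs) hd
    simp only [this, if_false, mul_zero]

lemma grgMeasure_eq (hw : ∀ x, 0 < w x) (E : Set (EdgeIdx N → Bool)) :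
    grgMeasure w E = ENNReal.ofReal (Pr w (fun ω => ω ∈ E)) := by
  have hsing : ∀ ω, grgMeasure w {ω} = ENNReal.ofReal (wt w ω) := by
    intro ω
    unfold grgMeasure wt
    rw [Measure.pi_singleton, ENNReal.ofReal_prod_of_nonneg]
    · refine Finset.prod_congr rfl fun e _ => ?_
      have : pS w (toS e) = pGRG w e.val.1 e.val.2 := rfl
      rw [this]
      unfold bern
      cases ω e <;> simp
    · intro e _
      split_ifs
      · exact pS_nonneg hw _
      · linarith [pS_le_one hw (toS e)]
  have hE : E = ((Finset.univ.filter fun ω => ω ∈ E : Finset (EdgeIdx N → Bool)) : Set _) := by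
    ext; simp
  conv_lhs => rw [hE]
  rw [← sum_measure_singleton]
  simp_rw [hsing]
  rw [← ENNReal.ofReal_sum_of_nonneg (fun ω _ => wt_nonneg hw ω)]
  congr 1
  unfold Pr Ex
  rw [Finset.sum_filter]
  refine Finset.sum_congr rfl fun ω _ => ?_
  by_cases h : ω ∈ E <;> simp [h]

end prob
end GRG

namespace GRG
variable {N : ℕ}
section cyc
open Classical

/-- the path `y, h 0, …, h (m-1), v` -/
noncomputable def earP {m : ℕ} (y : Fin N) (h : Fin m → Fin N) (v : Fin N) (i : ℕ) : Fin N :=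
  if i = 0 then y else if hi : i - 1 < m then h ⟨i - 1, hi⟩ else v

lemma earP_zero {m : ℕ} (y : Fin N) (h : Fin m → Fin N) (v : Fin N) : earP y h v 0 = y := by
  simp [earP]

lemma earP_last {m : ℕ} (y : Fin N) (h : Fin m → Fin N) (v : Fin N) : earP y h v (m + 1) = v := by
  simp [earP]

lemma earP_mid {m : ℕ} (y : Fin N) (h : Fin m → Fin N) (v : Fin N) (i : Fin m) :
    earP y h v (i + 1) = h i := by
  simp [earP]

/-- edges of an ear -/
noncomputable def earE {m : ℕ} (y : Fin N) (h : Fin m → Fin N) (v : Fin N) :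
    Finset (Sym2 (Fin N)) :=
  (Finset.range (m + 1)).image fun i => s(earP y h v i, earP y h v (i + 1))

/-- valid ears -/
def earV {m : ℕ} (F : Finset (Sym2 (Fin N))) (y : Fin N) (h : Fin m → Fin N) (v : Fin N) : Prop :=
  Set.InjOn (fun i => s(earP y h v i, earP y h v (i + 1))) (Finset.range (m + 1)) ∧
  Disjoint F (earE y h v) ∧ {z | s(y, z) ∈ earE y h v}.ncard ≤ 2

lemma ear_exists {A : Fin N → Fin N → Prop} {r : ℕ} {y z : Fin N} {F : Finset (Sym2 (Fin N))}
    {U : Finset (Fin N)} (hy : y ∈ U) (hF : ∀ s ∈ F, ∀ a ∈ s, a ∈ U)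
    (hz : z ∈ S1cycA A r y) (hzF : s(y, z) ∉ F) :
    ∃ m ∈ Finset.range (2 * r + 1), ∃ h : Fin m → Fin N, ∃ v ∈ U, earV F y h v ∧
      ∀ i < m + 1, A (earP y h v i) (earP y h v (i + 1)) := by
  obtain ⟨hA, l, γ, hl3, hlr, h0, h1, hl, hp, hsim⟩ := hz
  have hex : ∃ j, 1 ≤ j ∧ γ j ∈ U := ⟨l, by omega, by rw [hl]; exact hy⟩
  obtain ⟨hj1, hjU⟩ := Nat.find_spec hex
  have hjmin : ∀ i, 1 ≤ i → i < Nat.find hex → γ i ∉ U := fun i hi hlt hU =>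
    Nat.find_min hex hlt ⟨hi, hU⟩
  have hjl : Nat.find hex ≤ l := Nat.find_min' hex ⟨by omega, by rw [hl]; exact hy⟩
  generalize Nat.find hex = j at *
  obtain ⟨m, rfl⟩ : ∃ m, j = m + 1 := ⟨j - 1, by omega⟩
  have hP : ∀ i ≤ m + 1, earP y (fun i : Fin m => γ (i + 1)) (γ (m + 1)) i = γ i := by
    intro i hi
    rcases i with _ | i
    · rw [earP_zero, h0]
    · rcases Nat.lt_or_ge i m with h | h
      · exact earP_mid y _ _ ⟨i, h⟩
      · have : i = m := by omega
        subst this; rw [earP_last]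
  have hEm : ∀ s, s ∈ earE y (fun i : Fin m => γ (i + 1)) (γ (m + 1)) →
      ∃ i < m + 1, s = s(γ i, γ (i + 1)) := by
    intro s hs
    obtain ⟨i, hi, rfl⟩ := Finset.mem_image.1 hs
    have hi' := Finset.mem_range.1 hi
    exact ⟨i, hi', by rw [hP i (by omega), hP (i + 1) (by omega)]⟩
  have key : ∀ i k, i < k → k < m + 1 → s(γ i, γ (i + 1)) ≠ s(γ k, γ (k + 1)) := by
    intro i k hik hk he
    rcases Sym2.eq_iff.1 he with ⟨e, -⟩ | ⟨e, e'⟩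
    · exact hsim i k hik (by omega) (by omega) e
    · by_cases hc : i = 0 ∧ k + 1 = l
      · obtain ⟨rfl, hc⟩ := hc
        exact hsim 1 k (by omega) (by omega) (by omega) e'
      · exact hsim i (k + 1) (by omega) (by omega) hc e
  refine ⟨m, Finset.mem_range.2 (by omega), fun i => γ (i + 1), γ (m + 1), hjU, ⟨?_, ?_, ?_⟩, ?_⟩
  · intro i hi k hk he
    have hi' : i < m + 1 := by simpa using hi
    have hk' : k < m + 1 := by simpa using hk
    simp only [hP i (by omega), hP (i + 1) (by omega), hP k (by omega), hP (k + 1) (by omega)] at he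
    rcases lt_trichotomy i k with h | h | h
    · exact absurd he (key i k h hk')
    · exact h
    · exact absurd he.symm (key k i h hi')
  · rw [Finset.disjoint_left]
    intro s hs hs'
    obtain ⟨i, hi, rfl⟩ := hEm s hs'
    by_cases hm : m = 0
    · subst hm
      obtain rfl : i = 0 := by omega
      simp only [zero_add, h0, h1] at hs
      exact hzF hs
    · rcases i with _ | i
      · exact hjmin 1 le_rfl (by omega) (hF _ hs _ (by simp))
      · exact hjmin (i + 1) (by omega) hi (hF _ hs _ (by simp))
  · have hsub : {z | s(y, z) ∈ earE y (fun i : Fin m => γ (i + 1)) (γ (m + 1))} ⊆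
        ({γ 1, γ (l - 1)} : Set (Fin N)) := by
      intro z' hz'
      obtain ⟨i, hi, he⟩ := hEm _ hz'
      rcases Sym2.eq_iff.1 he with ⟨e, e'⟩ | ⟨e, e'⟩
      · have : i = 0 := by
          by_contra hne
          exact hsim 0 i (by omega) (by omega) (by omega) (by rw [h0, e])
        subst this
        left; exact e'
      · have : i + 1 = l := by
          by_contra hne
          exact hsim 0 (i + 1) (by omega) (by omega) (by omega) (by rw [h0, e])
        right; rw [e']; show γ i = γ (l - 1); congr 1; omega
    exact (Set.ncard_le_ncard hsub).trans ((Set.ncard_insert_le _ _).trans (by simp))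
  · intro i hi
    rw [hP i (by omega), hP (i + 1) (by omega)]
    exact hp i (by omega)

variable {w : Fin N → ℝ}

lemma ear_sum (hw : ∀ x, 0 < w x) (y v : Fin N) (m : ℕ) :
    ∑ h : Fin m → Fin N, ∏ i ∈ Finset.range (m + 1), pS w s(earP y h v i, earP y h v (i + 1)) ≤
      w y * w v / (∑ z, w z) * ((∑ z, w z ^ 2) / ∑ z, w z) ^ m := by
  set S := ∑ z, w z with hS
  have hSp : 0 < S := S_pos hw y
  have step : ∀ h : Fin m → Fin N,
      ∏ i ∈ Finset.range (m + 1), pS w s(earP y h v i, earP y h v (i + 1)) ≤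
      w y * w v / S * ∏ i, (w (h i) ^ 2 / S) := by
    intro h
    have hm : ∏ i ∈ Finset.range m, w (earP y h v (i + 1)) = ∏ i, w (h i) := by
      rw [Finset.prod_range]
      exact Finset.prod_congr rfl fun i _ => by rw [earP_mid]
    calc _ ≤ ∏ i ∈ Finset.range (m + 1), (w (earP y h v i) * w (earP y h v (i + 1)) / S) :=
          Finset.prod_le_prod (fun i _ => pS_nonneg hw _) fun i _ => by
            rw [pS_mk]; exact pGRG_le hw _ _
      _ = _ := by
          rw [Finset.prod_div_distrib, Finset.prod_mul_distrib,
            Finset.prod_range_succ' (fun i => w (earP y h v i)),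
            Finset.prod_range_succ (fun i => w (earP y h v (i + 1))), hm, earP_zero, earP_last,
            Finset.prod_div_distrib, Finset.prod_pow]
          simp only [Finset.prod_const, Finset.card_range, Finset.card_univ, Fintype.card_fin]
          field_simp
          ring
  refine (Finset.sum_le_sum fun h _ => step h).trans (le_of_eq ?_)
  rw [← Finset.mul_sum]
  congr 1
  have := Finset.prod_univ_sum (fun _ : Fin m => (Finset.univ : Finset (Fin N)))
    (fun _ b => w b ^ 2 / S)
  rw [Fintype.piFinset_univ] at this
  rw [← this, Finset.prod_const, Finset.sum_div]
  simp

lemma cyc_ind (hw : ∀ x, 0 < w x) (r : ℕ) (y : Fin N) (η : ℝ)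
    (hη : ∀ v, w y * w v / (∑ z, w z) *
      ∑ m ∈ Finset.range (2 * r + 1), ((∑ z, w z ^ 2) / ∑ z, w z) ^ m ≤ η) (k : ℕ) :
    ∀ (F : Finset (Sym2 (Fin N))) (U : Finset (Fin N)), y ∈ U → (∀ s ∈ F, ∀ a ∈ s, a ∈ U) →
    Pr w (fun ω => (∀ s ∈ F, pres ω s) ∧
      2 * k ≤ (S1cycA (Adj ω) r y \ {z | s(y, z) ∈ F}).ncard) ≤
    (∏ s ∈ F, pS w s) * (((U.card : ℝ) + 2 * r * k) * η) ^ k := by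
  have hSp : 0 < ∑ z, w z := S_pos hw y
  have hη0 : 0 ≤ η := by
    refine le_trans ?_ (hη y)
    have := hw y
    have h2 : 0 ≤ ∑ z, w z ^ 2 := Finset.sum_nonneg fun z _ => sq_nonneg _
    positivity
  induction k with
  | zero =>
    intro F U hy hF
    simp only [pow_zero, mul_one]
    exact (Pr_mono hw fun ω h => h.1).trans (Pr_pres_le hw F)
  | succ k ih =>
    intro F U hy hF
    set I : Finset (Σ m : ℕ, (Fin m → Fin N) × Fin N) :=
      (Finset.range (2 * r + 1)).sigma fun m => Finset.univ ×ˢ U with hI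
    have hun := Pr_union hw (I.filter fun e => earV F y e.2.1 e.2.2)
      (fun ω => (∀ s ∈ F, pres ω s) ∧
        2 * (k + 1) ≤ (S1cycA (Adj ω) r y \ {z | s(y, z) ∈ F}).ncard)
      (fun e ω => (∀ s ∈ F ∪ earE y e.2.1 e.2.2, pres ω s) ∧
        2 * k ≤ (S1cycA (Adj ω) r y \ {z | s(y, z) ∈ F ∪ earE y e.2.1 e.2.2}).ncard) (by
        rintro ω ⟨hp, hc⟩
        have hne : (S1cycA (Adj ω) r y \ {z | s(y, z) ∈ F}).Nonempty := by
          rw [← Set.ncard_pos]; omega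
        obtain ⟨z, hz, hzF⟩ := hne
        obtain ⟨m, hm, h, v, hv, hval, hadj⟩ := ear_exists hy hF hz hzF
        refine ⟨⟨m, h, v⟩, ?_, ?_, ?_⟩
        · rw [Finset.mem_filter]
          exact ⟨Finset.mem_sigma.2 ⟨hm, Finset.mem_product.2 ⟨Finset.mem_univ _, hv⟩⟩, hval⟩
        · intro s hs
          rcases Finset.mem_union.1 hs with hs | hs
          · exact hp s hs
          · obtain ⟨i, hi, rfl⟩ := Finset.mem_image.1 hs
            exact (Adj_iff _ _ _).1 (hadj i (Finset.mem_range.1 hi))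
        · have h1 : S1cycA (Adj ω) r y \ {z | s(y, z) ∈ F ∪ earE y h v} =
              (S1cycA (Adj ω) r y \ {z | s(y, z) ∈ F}) \ {z | s(y, z) ∈ earE y h v} := by
            ext z
            simp only [Set.mem_sdiff, Set.mem_ofPred_eq, Finset.mem_union]
            tauto
          show 2 * k ≤ (S1cycA (Adj ω) r y \ {z | s(y, z) ∈ F ∪ earE y h v}).ncard
          rw [h1]
          have h2 := Set.le_ncard_sdiff {z | s(y, z) ∈ earE y h v}
            (S1cycA (Adj ω) r y \ {z | s(y, z) ∈ F})
          have h3 := hval.2.2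
          omega)
    refine hun.trans ?_
    set B : ℝ := (((U.card : ℝ) + 2 * r * (k + 1 : ℕ)) * η) with hB
    have hB0 : 0 ≤ B := by positivity
    have hPF : 0 ≤ ∏ s ∈ F, pS w s := Finset.prod_nonneg fun s _ => pS_nonneg hw s
    have hterm : ∀ e ∈ I.filter (fun e => earV F y e.2.1 e.2.2),
        Pr w (fun ω => (∀ s ∈ F ∪ earE y e.2.1 e.2.2, pres ω s) ∧
        2 * k ≤ (S1cycA (Adj ω) r y \ {z | s(y, z) ∈ F ∪ earE y e.2.1 e.2.2}).ncard) ≤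
        (∏ s ∈ F, pS w s) * B ^ k *
          ∏ i ∈ Finset.range (e.1 + 1), pS w s(earP y e.2.1 e.2.2 i, earP y e.2.1 e.2.2 (i + 1)) := by
      rintro ⟨m, h, v⟩ he
      rw [Finset.mem_filter] at he
      obtain ⟨he, hval⟩ := he
      obtain ⟨hm, hv⟩ := Finset.mem_sigma.1 he
      have hv : v ∈ U := (Finset.mem_product.1 hv).2
      dsimp only at hval hm ⊢
      have hm := Finset.mem_range.1 hm
      have hi := ih (F ∪ earE y h v) (U ∪ Finset.univ.image h) (Finset.mem_union_left _ hy) (by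
        intro s hs a ha
        rcases Finset.mem_union.1 hs with hs | hs
        · exact Finset.mem_union_left _ (hF s hs a ha)
        · obtain ⟨i, hi, rfl⟩ := Finset.mem_image.1 hs
          have hmem : ∀ i, earP y h v i ∈ U ∪ Finset.univ.image h := by
            intro i
            unfold earP
            split_ifs
            · exact Finset.mem_union_left _ hy
            · exact Finset.mem_union_right _ (Finset.mem_image_of_mem _ (Finset.mem_univ _))
            · exact Finset.mem_union_left _ hv
          rcases Sym2.mem_iff.1 ha with rfl | rfl
          · exact hmem _
          · exact hmem _)
      refine hi.trans ?_
      rw [Finset.prod_union hval.2.1]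
      have hE : ∏ s ∈ earE y h v, pS w s =
          ∏ i ∈ Finset.range (m + 1), pS w s(earP y h v i, earP y h v (i + 1)) := by
        unfold earE
        rw [Finset.prod_image hval.1]
      rw [hE]
      have hcard : ((U ∪ Finset.univ.image h).card : ℝ) ≤ U.card + 2 * r := by
        have h1 : (U ∪ Finset.univ.image h).card ≤ U.card + 2 * r := by
          refine (Finset.card_union_le _ _).trans ?_
          have : (Finset.univ.image h).card ≤ m := by
            simpa using (Finset.card_image_le (s := Finset.univ) (f := h))
          omega
        exact_mod_cast h1
      have hpow : ((((U ∪ Finset.univ.image h).card : ℝ) + 2 * r * k) * η) ^ k ≤ B ^ k := by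
        apply pow_le_pow_left₀ (by positivity)
        rw [hB]
        apply mul_le_mul_of_nonneg_right _ hη0
        push_cast
        linarith
      have hq : 0 ≤ ∏ i ∈ Finset.range (m + 1), pS w s(earP y h v i, earP y h v (i + 1)) :=
        Finset.prod_nonneg fun i _ => pS_nonneg hw _
      calc _ ≤ ((∏ s ∈ F, pS w s) * ∏ i ∈ Finset.range (m + 1), pS w s(earP y h v i, earP y h v (i + 1))) * B ^ k :=
            mul_le_mul_of_nonneg_left hpow (mul_nonneg hPF hq)
        _ = _ := by ring
    refine (Finset.sum_le_sum hterm).trans ?_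
    rw [← Finset.mul_sum]
    have hsum : ∑ e ∈ I.filter (fun e => earV F y e.2.1 e.2.2),
        ∏ i ∈ Finset.range (e.1 + 1), pS w s(earP y e.2.1 e.2.2 i, earP y e.2.1 e.2.2 (i + 1))
        ≤ U.card * η := by
      refine (Finset.sum_le_sum_of_subset_of_nonneg (Finset.filter_subset _ _)
        (fun e _ _ => Finset.prod_nonneg fun i _ => pS_nonneg hw _)).trans ?_
      rw [hI, Finset.sum_sigma]
      calc _ = ∑ m ∈ Finset.range (2 * r + 1), ∑ v ∈ U, ∑ h : Fin m → Fin N,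
            ∏ i ∈ Finset.range (m + 1), pS w s(earP y h v i, earP y h v (i + 1)) := by
            refine Finset.sum_congr rfl fun m _ => ?_
            rw [Finset.sum_product_right]
        _ ≤ ∑ m ∈ Finset.range (2 * r + 1), ∑ v ∈ U,
            w y * w v / (∑ z, w z) * ((∑ z, w z ^ 2) / ∑ z, w z) ^ m :=
            Finset.sum_le_sum fun m _ => Finset.sum_le_sum fun v _ => ear_sum hw y v m
        _ = ∑ v ∈ U, w y * w v / (∑ z, w z) *
            ∑ m ∈ Finset.range (2 * r + 1), ((∑ z, w z ^ 2) / ∑ z, w z) ^ m := by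
            rw [Finset.sum_comm]
            simp_rw [Finset.mul_sum]
        _ ≤ ∑ v ∈ U, η := Finset.sum_le_sum fun v _ => hη v
        _ = _ := by simp
    have hUB : (U.card : ℝ) * η ≤ B := by
      rw [hB]
      apply mul_le_mul_of_nonneg_right _ hη0
      have : (0:ℝ) ≤ 2 * r * (k + 1 : ℕ) := by positivity
      linarith
    calc _ ≤ (∏ s ∈ F, pS w s) * B ^ k * B :=
          mul_le_mul_of_nonneg_left (hsum.trans hUB) (by positivity)
      _ = _ := by rw [pow_succ]; ring

lemma cyc_bound (hw : ∀ x, 0 < w x) (r : ℕ) (y : Fin N) (η : ℝ)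
    (hη : ∀ v, w y * w v / (∑ z, w z) *
      ∑ m ∈ Finset.range (2 * r + 1), ((∑ z, w z ^ 2) / ∑ z, w z) ^ m ≤ η) (k : ℕ) :
    Pr w (fun ω => 2 * k ≤ (S1cycA (Adj ω) r y).ncard) ≤ ((1 + 2 * r * k) * η) ^ k := by
  have := cyc_ind hw r y η hη k ∅ {y} (by simp) (by simp)
  simpa using this

end cyc
end GRG

namespace GRG
variable {N : ℕ}
section bad
open Classical

/-- the graph with `y` removed -/
def Gy (A : Fin N → Fin N → Prop) (hs : ∀ x y, A x y → A y x) (hi : ∀ x, ¬ A x x) (y : Fin N) :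
    SimpleGraph (Fin N) where
  Adj a b := A a b ∧ a ≠ y ∧ b ≠ y
  symm := ⟨fun a b h => ⟨hs a b h.1, h.2.2, h.2.1⟩⟩
  loopless := ⟨fun a h => hi a h.1⟩

lemma cyc_of_walk {A : Fin N → Fin N → Prop} (hs : ∀ x y, A x y → A y x) (hi : ∀ x, ¬ A x x)
    {r : ℕ} {y z z' : Fin N} (hz : A y z) (hz' : A y z') (hne : z ≠ z')
    (p : (Gy A hs hi y).Walk z z') (hp : p.length + 2 ≤ 2 * r + 1) : z ∈ S1cycA A r y := by
  obtain ⟨q, hq, hql⟩ : ∃ q : (Gy A hs hi y).Walk z z', q.IsPath ∧ q.length ≤ p.length :=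
    ⟨p.bypass, p.bypass_isPath, p.length_bypass_le_length⟩
  have hzy : z ≠ y := fun h => hi y (by rw [h] at hz; exact hz)
  have hzy' : z' ≠ y := fun h => hi y (by rw [h] at hz'; exact hz')
  have hq1 : 1 ≤ q.length := by
    by_contra h
    exact hne (SimpleGraph.Walk.eq_of_length_eq_zero (by omega : q.length = 0))
  have hqy : ∀ i ≤ q.length, q.getVert i ≠ y := by
    intro i hi'
    rcases Nat.lt_or_ge i q.length with h | h
    · exact (q.adj_getVert_succ h).2.1
    · have : i = q.length := by omega
      subst this; rw [SimpleGraph.Walk.getVert_length]; exact hzy'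
  set γ : ℕ → Fin N := fun i => if i = 0 ∨ i = q.length + 2 then y else q.getVert (i - 1) with hγ
  have g0 : γ 0 = y := by simp [hγ]
  have gl : γ (q.length + 2) = y := by simp [hγ]
  have gm : ∀ i ≤ q.length, γ (i + 1) = q.getVert i := by
    intro i hi'
    have : ¬ (i + 1 = 0 ∨ i + 1 = q.length + 2) := by omega
    simp only [hγ, this, if_false]
    congr 1
  refine ⟨hz, q.length + 2, γ, by omega, by omega, g0, ?_, gl, ?_, ?_⟩
  · rw [gm 0 (by omega)]; simp
  · intro i hi'
    rcases i with _ | i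
    · rw [g0, gm 0 (by omega)]; simpa using hz
    · rw [gm i (by omega)]
      rcases Nat.lt_or_ge i q.length with h | h
      · rw [gm (i + 1) (by omega)]
        exact (q.adj_getVert_succ h).1
      · have : i = q.length := by omega
        subst this
        rw [SimpleGraph.Walk.getVert_length, gl]
        exact hs _ _ hz'
  · intro i j hij hj hn he
    rcases i with _ | i
    · obtain ⟨j, rfl⟩ : ∃ k, j = k + 1 := ⟨j - 1, by omega⟩
      rw [g0, gm j (by omega)] at he
      exact hqy j (by omega) he.symm
    · obtain ⟨j, rfl⟩ : ∃ k, j = k + 1 := ⟨j - 1, by omega⟩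
      rw [gm i (by omega)] at he
      rcases Nat.lt_or_ge q.length j with h | h
      · have : j = q.length + 1 := by omega
        subst this
        rw [gl] at he
        exact hqy i (by omega) he
      · rw [gm j h] at he
        have := hq.getVert_injOn (by simp; omega) (by simp; omega) he
        omega

/-- short path types -/
abbrev PT (N : ℕ) := Option (Fin N) × Fin N

/-- edges of a short path starting from `z` -/
noncomputable def pE (z : Fin N) : PT N → Finset (Sym2 (Fin N))
  | (none, u) => {s(z, u)}
  | (some t, u) => {s(z, t), s(t, u)}

/-- validity of a short path -/
def pV (y z : Fin N) : PT N → Prop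
  | (none, u) => u ≠ y
  | (some t, u) => t ≠ y ∧ u ≠ y ∧ u ≠ z

/-- bound on the probability of a short path -/
noncomputable def pq (w : Fin N → ℝ) (z : Fin N) : PT N → ℝ
  | (none, u) => w z * w u / ∑ x, w x
  | (some t, u) => (w z * w t / ∑ x, w x) * (w t * w u / ∑ x, w x)

/-- bad neighbours of `y` -/
def Bad (ω : EdgeIdx N → Bool) (r : ℕ) (X : ℝ) (y z : Fin N) : Prop :=
  Adj ω y z ∧ z ∉ S1cycA (Adj ω) r y ∧
    (X ≤ (degA (Adj ω) z : ℝ) ∨ ∃ t, t ≠ y ∧ Adj ω z t ∧ X ≤ (degA (Adj ω) t : ℝ))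

lemma pE_walk {ω : EdgeIdx N → Bool} {y z : Fin N} (hzy : z ≠ y) {c : PT N} (hv : pV y z c)
    (hp : ∀ s ∈ pE z c, pres ω s) {s : Sym2 (Fin N)} (hsE : s ∈ pE z c) {a : Fin N} (ha : a ∈ s) :
    a ≠ y ∧ ∃ p : (Gy (Adj ω) (Adj_symm ω) (Adj_irrefl ω) y).Walk z a, p.length ≤ 2 := by
  rcases c with ⟨_ | t, u⟩
  · simp only [pE, Finset.mem_singleton] at hsE hp
    simp only [pV] at hv
    subst hsE
    have hadj : (Gy (Adj ω) (Adj_symm ω) (Adj_irrefl ω) y).Adj z u :=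
      ⟨(Adj_iff _ _ _).2 (hp _ rfl), hzy, hv⟩
    rcases Sym2.mem_iff.1 ha with rfl | rfl
    · exact ⟨hzy, SimpleGraph.Walk.nil, by simp⟩
    · exact ⟨hv, hadj.toWalk, by simp⟩
  · simp only [pE, Finset.mem_insert, Finset.mem_singleton] at hsE hp
    obtain ⟨hty, huy, huz⟩ := hv
    have h1 : (Gy (Adj ω) (Adj_symm ω) (Adj_irrefl ω) y).Adj z t :=
      ⟨(Adj_iff _ _ _).2 (hp _ (Or.inl rfl)), hzy, hty⟩
    have h2 : (Gy (Adj ω) (Adj_symm ω) (Adj_irrefl ω) y).Adj t u :=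
      ⟨(Adj_iff _ _ _).2 (hp _ (Or.inr rfl)), hty, huy⟩
    have : a = z ∨ a = t ∨ a = u := by
      rcases hsE with rfl | rfl
      · rcases Sym2.mem_iff.1 ha with rfl | rfl <;> tauto
      · rcases Sym2.mem_iff.1 ha with rfl | rfl <;> tauto
    rcases this with rfl | rfl | rfl
    · exact ⟨hzy, SimpleGraph.Walk.nil, by simp⟩
    · exact ⟨hty, h1.toWalk, by simp⟩
    · exact ⟨huy, SimpleGraph.Walk.cons h1 h2.toWalk, by simp⟩

lemma pE_disj {ω : EdgeIdx N → Bool} {r : ℕ} (hr : 6 ≤ r) {X : ℝ} {y z z' : Fin N} (hne : z ≠ z')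
    (hz : Bad ω r X y z) (hz' : Bad ω r X y z') {c c' : PT N} (hv : pV y z c) (hv' : pV y z' c')
    (hp : ∀ s ∈ pE z c, pres ω s) (hp' : ∀ s ∈ pE z' c', pres ω s) :
    Disjoint (pE z c) (pE z' c') := by
  rw [Finset.disjoint_left]
  intro s h h'
  have hzy : z ≠ y := fun h => Adj_irrefl ω y (by have := hz.1; rwa [h] at this)
  have hzy' : z' ≠ y := fun h => Adj_irrefl ω y (by have := hz'.1; rwa [h] at this)
  have ha : s.out.1 ∈ s := Sym2.out_fst_mem s
  obtain ⟨-, p, hpl⟩ := pE_walk hzy hv hp h ha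
  obtain ⟨-, p', hpl'⟩ := pE_walk hzy' hv' hp' h' ha
  refine hz.2.1 (cyc_of_walk (Adj_symm ω) (Adj_irrefl ω) hz.1 hz'.1 hne (p.append p'.reverse) ?_)
  simp only [SimpleGraph.Walk.length_append, SimpleGraph.Walk.length_reverse]
  omega

lemma bad_count {ω : EdgeIdx N → Bool} {r : ℕ} {X : ℝ} {y z : Fin N} (hz : Bad ω r X y z) :
    X - 2 ≤ ((Finset.univ.filter fun c : PT N => pV y z c ∧ ∀ s ∈ pE z c, pres ω s).card : ℝ) := by
  have hcard : ∀ t, degA (Adj ω) t = (Finset.univ.filter fun u => Adj ω t u).card := by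
    intro t
    unfold degA
    rw [Set.ncard_eq_toFinset_card']
    congr 1; ext; simp
  rcases hz.2.2 with h | ⟨t, hty, hzt, h⟩
  · have h1 : ((Finset.univ.filter fun u => Adj ω z u) \ {y}).card ≤
        (Finset.univ.filter fun c : PT N => pV y z c ∧ ∀ s ∈ pE z c, pres ω s).card := by
      refine Finset.card_le_card_of_injOn (fun u => (none, u)) ?_ ?_
      · intro u hu
        simp only [Finset.coe_sdiff, Finset.coe_filter, Finset.mem_univ, true_and,
          Finset.coe_singleton, Set.mem_sdiff, Set.mem_ofPred_eq, Set.mem_singleton_iff] at hu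
        refine Finset.mem_coe.2 (Finset.mem_filter.2 ⟨Finset.mem_univ _, hu.2, ?_⟩)
        intro s hs
        obtain rfl := Finset.mem_singleton.1 hs
        exact (Adj_iff _ _ _).1 hu.1
      · intro a _ b _ h; simpa using h
    have h2 := Finset.le_card_sdiff {y} (Finset.univ.filter fun u => Adj ω z u)
    rw [hcard] at h
    have h3 : (Finset.univ.filter fun u => Adj ω z u).card ≤ 
        (Finset.univ.filter fun c : PT N => pV y z c ∧ ∀ s ∈ pE z c, pres ω s).card + 1 := by
      simp at h2; omega
    have h4 : ((Finset.univ.filter fun u => Adj ω z u).card : ℝ) ≤ 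
        (Finset.univ.filter fun c : PT N => pV y z c ∧ ∀ s ∈ pE z c, pres ω s).card + 1 := by
      exact_mod_cast h3
    linarith
  · have h1 : ((Finset.univ.filter fun u => Adj ω t u) \ {y, z}).card ≤
        (Finset.univ.filter fun c : PT N => pV y z c ∧ ∀ s ∈ pE z c, pres ω s).card := by
      refine Finset.card_le_card_of_injOn (fun u => (some t, u)) ?_ ?_
      · intro u hu
        simp only [Finset.coe_sdiff, Finset.coe_filter, Finset.mem_univ, true_and,
          Finset.coe_insert,
          Finset.coe_singleton, Set.mem_sdiff, Set.mem_ofPred_eq, Set.mem_singleton_iff,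
          Set.mem_insert_iff, not_or] at hu
        refine Finset.mem_coe.2 (Finset.mem_filter.2 ⟨Finset.mem_univ _, ⟨hty, hu.2⟩, ?_⟩)
        intro s hs
        simp only [pE, Finset.mem_singleton, Finset.mem_insert] at hs
        rcases hs with rfl | rfl
        · exact (Adj_iff _ _ _).1 hzt
        · exact (Adj_iff _ _ _).1 hu.1
      · intro a _ b _ h; simpa using h
    have h2 := Finset.le_card_sdiff {y, z} (Finset.univ.filter fun u => Adj ω t u)
    have h5 : ({y, z} : Finset (Fin N)).card ≤ 2 := Finset.card_le_two
    rw [hcard] at h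
    have h3 : (Finset.univ.filter fun u => Adj ω t u).card ≤ 
        (Finset.univ.filter fun c : PT N => pV y z c ∧ ∀ s ∈ pE z c, pres ω s).card + 2 := by
      omega
    have h4 : ((Finset.univ.filter fun u => Adj ω t u).card : ℝ) ≤ 
        (Finset.univ.filter fun c : PT N => pV y z c ∧ ∀ s ∈ pE z c, pres ω s).card + 2 := by
      exact_mod_cast h3
    linarith

end bad
end GRG

namespace GRG
variable {N : ℕ}
section expmom
open Classical

/-- vertices other than `y` -/
abbrev Vy (y : Fin N) := {z : Fin N // z ≠ y}

/-- edges of an optional short path -/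
noncomputable def oE (z : Fin N) : Option (PT N) → Finset (Sym2 (Fin N))
  | none => ∅
  | some c => pE z c

/-- indicator weight of an optional short path -/
noncomputable def phi (ω : EdgeIdx N → Bool) (r : ℕ) (X κ : ℝ) (y z : Fin N) : Option (PT N) → ℝ
  | none => 1
  | some c => if Bad ω r X y z ∧ pV y z c ∧ ∀ s ∈ pE z c, pres ω s then κ else 0

/-- bound on the expectation of `phi` -/
noncomputable def psi (w : Fin N → ℝ) (κ : ℝ) (y z : Fin N) : Option (PT N) → ℝ
  | none => 1 - pGRG w y z / 2
  | some c => κ * (pGRG w y z / 2 * pq w z c)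

variable {w : Fin N → ℝ}

lemma pq_nonneg (hw : ∀ x, 0 < w x) (z : Fin N) (c : PT N) : 0 ≤ pq w z c := by
  have := S_pos hw z
  rcases c with ⟨_ | t, u⟩
  · have := hw z; have := hw u
    simp only [pq]; positivity
  · have := hw z; have := hw u; have := hw t
    simp only [pq]; positivity

lemma prod_pE_le (hw : ∀ x, 0 < w x) (y z : Fin N) (c : PT N) (hc : pV y z c) :
    ∏ s ∈ pE z c, pS w s ≤ pq w z c := by
  rcases c with ⟨_ | t, u⟩
  · simp only [pE, pq, Finset.prod_singleton, pS_mk]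
    exact pGRG_le hw z u
  · obtain ⟨h1, h2, h3⟩ := hc
    have hne : s(z, t) ≠ s(t, u) := by
      intro h
      rcases Sym2.eq_iff.1 h with ⟨rfl, e⟩ | ⟨e, -⟩
      · exact h3 e.symm
      · exact h3 e.symm
    simp only [pE, pq]
    rw [Finset.prod_pair hne, pS_mk, pS_mk]
    exact mul_le_mul (pGRG_le hw z t) (pGRG_le hw t u) (pGRG_nonneg hw _ _)
      ((pGRG_nonneg hw _ _).trans (pGRG_le hw z t))

lemma psi_nonneg (hw : ∀ x, 0 < w x) {κ : ℝ} (hκ : 0 ≤ κ) (y z : Fin N) (o : Option (PT N)) :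
    0 ≤ psi w κ y z o := by
  have h1 := pGRG_nonneg hw y z
  have h2 := pGRG_le_one hw y z
  rcases o with _ | c
  · simp only [psi]; linarith
  · have := pq_nonneg hw z c
    simp only [psi]; positivity

lemma star_inj (y : Fin N) : Function.Injective (fun z : Vy y => s(y, (z : Fin N))) := by
  rintro ⟨a, ha⟩ ⟨b, hb⟩ h
  rcases Sym2.eq_iff.1 h with ⟨-, e⟩ | ⟨e, -⟩
  · exact Subtype.ext e
  · exact absurd e.symm hb

lemma term_bound (hw : ∀ x, 0 < w x) {r : ℕ} (hr : 6 ≤ r) (X : ℝ) {κ : ℝ} (hκ : 0 ≤ κ) (y : Fin N)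
    (g : Vy y → Option (PT N)) :
    Ex w (fun ω => (∏ z : Vy y, if Adj ω y z then (1 / 2 : ℝ) else 1) *
      ∏ z : Vy y, phi ω r X κ y z (g z)) ≤ ∏ z : Vy y, psi w κ y z (g z) := by
  have hpsi : 0 ≤ ∏ z : Vy y, psi w κ y z (g z) :=
    Finset.prod_nonneg fun z _ => psi_nonneg hw hκ _ _ _
  by_cases good : (∀ z z' : Vy y, z ≠ z' → Disjoint (oE z (g z)) (oE z' (g z'))) ∧
      ∀ z : Vy y, (∀ s ∈ oE z (g z), y ∉ s ∧ ¬ s.IsDiag) ∧ ∀ c, g z = some c → pV y z c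
  swap
  · refine le_trans (le_of_eq ?_) hpsi
    unfold Ex
    refine Finset.sum_eq_zero fun ω _ => ?_
    suffices h : ∏ z : Vy y, phi ω r X κ y z (g z) = 0 by dsimp only; rw [h]; simp
    by_contra hne
    apply good
    have hall : ∀ (z : Vy y) c, g z = some c →
        Bad ω r X y z ∧ pV y z c ∧ ∀ s ∈ pE (z : Fin N) c, pres ω s := by
      intro z c hc
      by_contra hn
      apply hne
      refine Finset.prod_eq_zero (Finset.mem_univ z) ?_
      rw [hc]; simp only [phi]; rw [if_neg hn]
    refine ⟨?_, fun z => ⟨?_, fun c hc => (hall z c hc).2.1⟩⟩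
    · intro z z' hzz
      rcases hg : g z with _ | c
      · simp [oE]
      rcases hg' : g z' with _ | c'
      · simp [oE]
      have h := hall z c hg
      have h' := hall z' c' hg'
      exact pE_disj hr (fun e => hzz (Subtype.ext e)) h.1 h'.1 h.2.1 h'.2.1 h.2.2 h'.2.2
    · intro s hs
      rcases hg : g z with _ | c
      · rw [hg] at hs; simp [oE] at hs
      rw [hg] at hs
      have h := hall z c hg
      exact ⟨fun hy => (pE_walk z.2 h.2.1 h.2.2 hs hy).1 rfl, pres_not_diag (h.2.2 s hs)⟩
  · obtain ⟨hdis, hg⟩ := good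
    set F1 : Finset (Sym2 (Fin N)) := Finset.univ.image (fun z : Vy y => s(y, (z : Fin N))) with hF1
    set F2 : Finset (Sym2 (Fin N)) := Finset.univ.biUnion (fun z : Vy y => oE z (g z)) with hF2
    have hyF1 : ∀ s ∈ F1, y ∈ s := by
      intro s hs
      obtain ⟨z, -, rfl⟩ := Finset.mem_image.1 hs
      simp
    have hyF2 : ∀ s ∈ F2, y ∉ s ∧ ¬ s.IsDiag := by
      intro s hs
      obtain ⟨z, -, hz⟩ := Finset.mem_biUnion.1 hs
      exact (hg z).1 s hz
    have hd12 : Disjoint F1 F2 := by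
      rw [Finset.disjoint_left]
      intro s h1 h2
      exact (hyF2 s h2).1 (hyF1 s h1)
    set α : Sym2 (Fin N) → ℝ := fun s => if y ∈ s then 1 / 2 else 1 with hα
    set β : Sym2 (Fin N) → ℝ := fun s => if ∃ z : Vy y, s = s(y, (z : Fin N)) ∧ g z = none then 1 else 0
      with hβ
    have hβ1 : ∀ z : Vy y, β s(y, (z : Fin N)) = if g z = none then 1 else 0 := by
      intro z
      simp only [hβ]
      congr 1
      apply propext
      constructor
      · rintro ⟨z', h, h'⟩
        rw [star_inj y h]; exact h'
      · exact fun h => ⟨z, rfl, h⟩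
    have hβ2 : ∀ s ∈ F2, β s = 0 := by
      intro s hs
      simp only [hβ]
      rw [if_neg]
      rintro ⟨z, rfl, -⟩
      exact (hyF2 _ hs).1 (by simp)
    have hα1 : ∀ z : Vy y, α s(y, (z : Fin N)) = 1 / 2 := by intro z; simp [hα]
    have hα2 : ∀ s ∈ F2, α s = 1 := by
      intro s hs
      simp only [hα]
      rw [if_neg (hyF2 _ hs).1]
    set K : ℝ := ∏ z : Vy y, if g z = none then 1 else κ with hK
    have hnd : ∀ s ∈ F1 ∪ F2, ¬ s.IsDiag := by
      intro s hs
      rcases Finset.mem_union.1 hs with h | h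
      · obtain ⟨z, -, rfl⟩ := Finset.mem_image.1 h
        rw [Sym2.mk_isDiag_iff]
        exact fun e => z.2 e.symm
      · exact (hyF2 s h).2
    have hsplit : ∀ f : Sym2 (Fin N) → ℝ, ∏ s ∈ F1 ∪ F2, f s =
        (∏ z : Vy y, f s(y, (z : Fin N))) * ∏ s ∈ F2, f s := by
      intro f
      rw [Finset.prod_union hd12, hF1, Finset.prod_image (fun a _ b _ h => star_inj y h)]
    have hK0 : 0 ≤ K := Finset.prod_nonneg fun z _ => by split_ifs <;> linarith
    have hpt : ∀ ω, (∏ z : Vy y, if Adj ω y z then (1 / 2 : ℝ) else 1) *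
        ∏ z : Vy y, phi ω r X κ y z (g z) ≤
        K * ∏ s ∈ F1 ∪ F2, if pres ω s then α s else β s := by
      intro ω
      have hprodnn : 0 ≤ ∏ s ∈ F1 ∪ F2, if pres ω s then α s else β s := by
        refine Finset.prod_nonneg fun s _ => ?_
        simp only [hα, hβ]
        split_ifs <;> norm_num
      by_cases hall : ∀ (z : Vy y) c, g z = some c →
        Bad ω r X y z ∧ pV y z c ∧ ∀ s ∈ pE (z : Fin N) c, pres ω s
      · apply le_of_eq
        rw [mul_comm]
        have e1 : ∏ z : Vy y, phi ω r X κ y z (g z) = K := by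
          refine Finset.prod_congr rfl fun z _ => ?_
          rcases hgz : g z with _ | c
          · simp [phi]
          · simp only [phi]
            rw [if_pos (hall z c hgz)]; simp
        rw [e1, hsplit]
        have e2 : ∏ s ∈ F2, (if pres ω s then α s else β s) = 1 := by
          refine Finset.prod_eq_one fun s hs => ?_
          rw [if_pos, hα2 s hs]
          obtain ⟨z, -, hz⟩ := Finset.mem_biUnion.1 hs
          rcases hgz : g z with _ | c
          · rw [hgz] at hz; simp [oE] at hz
          · rw [hgz] at hz
            exact (hall z c hgz).2.2 s hz
        rw [e2, mul_one]
        congr 1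
        refine Finset.prod_congr rfl fun z _ => ?_
        rw [hα1, hβ1]
        simp only [← Adj_iff]
        rcases hgz : g z with _ | c
        · simp
        · have := (hall z c hgz).1.1
          simp [this]
      · push Not at hall
        obtain ⟨z, c, hc, hn⟩ := hall
        have : ∏ z : Vy y, phi ω r X κ y z (g z) = 0 := by
          refine Finset.prod_eq_zero (Finset.mem_univ z) ?_
          rw [hc]; simp only [phi]; rw [if_neg]
          rintro ⟨h1, h2, h3⟩
          obtain ⟨s, hs, hs'⟩ := hn h1 h2
          exact hs' (h3 s hs)
        rw [this, mul_zero]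
        exact mul_nonneg hK0 hprodnn
    refine (Ex_mono hw hpt).trans ?_
    rw [Ex_const_mul, Ex_prod_sym _ hnd, hsplit]
    have e3 : ∏ s ∈ F2, (pS w s * α s + (1 - pS w s) * β s) =
        ∏ z : Vy y, ∏ s ∈ oE z (g z), pS w s := by
      rw [← Finset.prod_biUnion (fun z _ z' _ h => hdis z z' h)]
      refine Finset.prod_congr rfl fun s hs => ?_
      rw [hα2 s hs, hβ2 s hs]; ring
    rw [e3, hK, ← Finset.prod_mul_distrib, ← Finset.prod_mul_distrib]
    refine Finset.prod_le_prod ?_ ?_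
    · intro z _
      have h0 : 0 ≤ ∏ s ∈ oE z (g z), pS w s := Finset.prod_nonneg fun s _ => pS_nonneg hw s
      have h1 := pS_nonneg hw s(y, (z : Fin N))
      have h2 := pS_le_one hw s(y, (z : Fin N))
      rw [hα1, hβ1]
      split_ifs
      · refine mul_nonneg zero_le_one (mul_nonneg ?_ h0); linarith
      · refine mul_nonneg hκ (mul_nonneg ?_ h0); linarith
    · intro z _
      rw [hα1, hβ1, pS_mk]
      rcases hgz : g z with _ | c
      · simp only [if_true, oE, psi, Finset.prod_empty]
        apply le_of_eq; ring
      · have h1 := prod_pE_le hw y z c ((hg z).2 c hgz)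
        have h2 := pGRG_nonneg hw y z
        simp only [reduceCtorEq, if_false, oE, psi]
        apply mul_le_mul_of_nonneg_left _ hκ
        rw [mul_zero, add_zero, mul_one_div]
        exact mul_le_mul_of_nonneg_left h1 (by linarith)

lemma sum_pq (hw : ∀ x, 0 < w x) (z : Fin N) :
    ∑ c, pq w z c = w z * (1 + (∑ x, w x ^ 2) / ∑ x, w x) := by
  have hS := S_pos hw z
  rw [Fintype.sum_prod_type, Fintype.sum_option]
  simp only [pq]
  simp_rw [← Finset.mul_sum, ← Finset.sum_div, ← Finset.mul_sum]
  rw [mul_div_assoc, div_self hS.ne']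
  have : ∀ x, w z * w x / (∑ x, w x) * (w x * (∑ x, w x) / ∑ x, w x) =
      w z / (∑ x, w x) * w x ^ 2 := by
    intro x; field_simp
  simp_rw [this]
  rw [← Finset.mul_sum]
  ring

lemma expmom_le (hw : ∀ x, 0 < w x) {r : ℕ} (hr : 6 ≤ r) {X b : ℝ} (hX : 2 < X) (hb : 1 ≤ b)
    (y : Fin N) :
    Ex w (fun ω => (∏ z : Vy y, if Adj ω y z then (1 / 2 : ℝ) else 1) *
      ∏ z : Vy y, if Bad ω r X y z then b else 1) ≤
    ∏ z : Vy y, (1 - pGRG w y z / 2 + (b - 1) / (X - 2) * (pGRG w y z / 2 *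
      (w z * (1 + (∑ x, w x ^ 2) / ∑ x, w x)))) := by
  set κ := (b - 1) / (X - 2) with hκd
  have hκ : 0 ≤ κ := div_nonneg (by linarith) (by linarith)
  have h1 : ∀ ω, (∏ z : Vy y, if Adj ω y z then (1 / 2 : ℝ) else 1) *
      (∏ z : Vy y, if Bad ω r X y z then b else 1) ≤
      ∑ g : Vy y → Option (PT N), (∏ z : Vy y, if Adj ω y z then (1 / 2 : ℝ) else 1) *
        ∏ z : Vy y, phi ω r X κ y z (g z) := by
    intro ω
    rw [← Finset.mul_sum]
    apply mul_le_mul_of_nonneg_left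
    · have := Finset.prod_univ_sum (fun _ : Vy y => (Finset.univ : Finset (Option (PT N))))
        (fun z o => phi ω r X κ y z o)
      rw [Fintype.piFinset_univ] at this
      rw [← this]
      refine Finset.prod_le_prod ?_ ?_
      · intro z _; split_ifs <;> linarith
      · intro z _
        rw [Fintype.sum_option]
        simp only [phi]
        by_cases hbad : Bad ω r X y z
        · have hc := bad_count hbad
          rw [if_pos hbad]
          simp only [hbad, true_and]
          rw [← Finset.sum_filter, Finset.sum_const, nsmul_eq_mul]
          have : (X - 2) * κ = b - 1 := by
            rw [hκd]; exact mul_div_cancel₀ _ (by linarith)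
          nlinarith [mul_le_mul_of_nonneg_right hc hκ]
        · simp [hbad]
    · exact Finset.prod_nonneg fun z _ => by split_ifs <;> norm_num
  refine (Ex_mono hw h1).trans ?_
  rw [Ex_sum]
  refine (Finset.sum_le_sum fun g _ => term_bound hw hr X hκ y g).trans (le_of_eq ?_)
  have := Finset.prod_univ_sum (fun _ : Vy y => (Finset.univ : Finset (Option (PT N))))
    (fun z o => psi w κ y z o)
  rw [Fintype.piFinset_univ] at this
  rw [← this]
  refine Finset.prod_congr rfl fun z _ => ?_
  rw [Fintype.sum_option]
  simp only [psi]
  rw [← Finset.mul_sum, ← Finset.mul_sum, sum_pq hw]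

lemma expmom_le_one (hw : ∀ x, 0 < w x) {r : ℕ} (hr : 6 ≤ r) {X b : ℝ} (hX : 2 < X) (hb : 1 ≤ b)
    (y : Fin N) (hS1 : ∀ x, w y * w x ≤ ∑ z, w z) (hS2 : 2 * w y ≤ ∑ z, w z)
    (hM : 4 * (b - 1) * (1 + (∑ x, w x ^ 2) / ∑ x, w x) * ((∑ x, w x ^ 2) / ∑ x, w x) ≤ X - 2) :
    Ex w (fun ω => (∏ z : Vy y, if Adj ω y z then (1 / 2 : ℝ) else 1) *
      ∏ z : Vy y, if Bad ω r X y z then b else 1) ≤ 1 := by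
  refine (expmom_le hw hr hX hb y).trans ?_
  set S := ∑ x, w x with hS
  have hSp : 0 < S := S_pos hw y
  set M := (∑ x, w x ^ 2) / S with hMd
  have hM0 : 0 ≤ M := div_nonneg (Finset.sum_nonneg fun z _ => sq_nonneg _) hSp.le
  set κ := (b - 1) / (X - 2) with hκd
  have hκ : 0 ≤ κ := div_nonneg (by linarith) (by linarith)
  have hκM : 4 * κ * (1 + M) * M ≤ 1 := by
    have : 4 * κ * (1 + M) * M = 4 * (b - 1) * (1 + M) * M / (X - 2) := by rw [hκd]; ring
    rw [this, div_le_one (by linarith)]; exact hM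
  have hy := hw y
  have hsumV : ∀ f : Fin N → ℝ, ∑ z : Vy y, f z = ∑ z, f z - f y := by
    intro f
    have h1 : ∑ z : Vy y, f z = ∑ z ∈ Finset.univ.erase y, f z := by
      rw [Finset.sum_subtype (Finset.univ.erase y) (p := fun z => z ≠ y)]
      intro x; simp
    rw [h1, ← Finset.add_sum_erase _ f (Finset.mem_univ y)]; ring
  have hlow : w y / 4 ≤ ∑ z : Vy y, pGRG w y z := by
    have h1 : ∀ z : Vy y, w y / (2 * S) * w z ≤ pGRG w y z := by
      intro z
      unfold pGRG
      rw [div_mul_eq_mul_div]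
      have := hw z
      apply div_le_div_of_nonneg_left (by positivity) (by positivity)
      have := hS1 z
      rw [← hS]; linarith
    refine le_trans ?_ (Finset.sum_le_sum fun z _ => h1 z)
    rw [← Finset.mul_sum, hsumV (fun z => w z), ← hS]
    rw [div_mul_eq_mul_div, div_le_div_iff₀ (by norm_num) (by positivity)]
    nlinarith
  have hup : ∑ z : Vy y, pGRG w y z * w z ≤ w y * M := by
    have h1 : ∀ z : Vy y, pGRG w y z * w z ≤ w y / S * w z ^ 2 := by
      intro z
      have := mul_le_mul_of_nonneg_right (pGRG_le hw y z) (hw z).le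
      refine this.trans (le_of_eq ?_)
      rw [← hS]; ring
    refine (Finset.sum_le_sum fun z _ => h1 z).trans ?_
    rw [← Finset.mul_sum, hsumV (fun z => w z ^ 2), hMd]
    have : w y / S * w y ^ 2 ≥ 0 := by positivity
    have e : w y * ((∑ x, w x ^ 2) / S) = w y / S * ∑ x, w x ^ 2 := by ring
    rw [e]; nlinarith
  calc _ ≤ ∏ z : Vy y, Real.exp (-(pGRG w y z / 2) + κ * (1 + M) / 2 * (pGRG w y z * w z)) := by
        refine Finset.prod_le_prod ?_ ?_
        · intro z _
          have h1 := pGRG_nonneg hw y z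
          have h2 := pGRG_le_one hw y z
          have h3 := hw z
          have : 0 ≤ κ * (pGRG w y z / 2 * (w z * (1 + M))) := by positivity
          linarith
        · intro z _
          refine le_trans (le_of_eq ?_) (Real.add_one_le_exp _)
          ring
    _ = Real.exp (-(∑ z : Vy y, pGRG w y z) / 2 + κ * (1 + M) / 2 * ∑ z : Vy y, pGRG w y z * w z) := by
        rw [← Real.exp_sum, Finset.sum_add_distrib, ← Finset.mul_sum, Finset.sum_neg_distrib,
          ← Finset.sum_div, neg_div]
    _ ≤ 1 := by
        rw [Real.exp_le_one_iff]
        have h1 : κ * (1 + M) / 2 * ∑ z : Vy y, pGRG w y z * w z ≤ κ * (1 + M) / 2 * (w y * M) :=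
          mul_le_mul_of_nonneg_left hup (by positivity)
        have h2 : κ * (1 + M) / 2 * (w y * M) = (4 * κ * (1 + M) * M) * (w y / 8) := by ring
        have h3 : (4 * κ * (1 + M) * M) * (w y / 8) ≤ 1 * (w y / 8) :=
          mul_le_mul_of_nonneg_right hκM (by positivity)
        linarith

end expmom
end GRG

namespace GRG
variable {N : ℕ}
section combine
open Classical

lemma S1cyc_symm {A : Fin N → Fin N → Prop} (hs : ∀ x y, A x y → A y x) {r : ℕ} {y z : Fin N}
    (h : z ∈ S1cycA A r y) : y ∈ S1cycA A r z := by
  obtain ⟨hA, l, γ, hl3, hlr, h0, h1, hl, hp, hsim⟩ := h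
  set γ' : ℕ → Fin N := fun i => if i = 0 then γ 1 else γ (l + 1 - i) with hγ'
  have g0 : γ' 0 = γ 1 := by simp [hγ']
  have gs : ∀ i, γ' (i + 1) = γ (l - i) := by
    intro i; simp only [hγ', Nat.succ_ne_zero, if_false]; congr 1; omega
  refine ⟨hs _ _ hA, l, γ', hl3, hlr, by rw [g0, h1], ?_, ?_, ?_, ?_⟩
  · rw [show (1:ℕ) = 0 + 1 from rfl, gs, Nat.sub_zero, hl]
  · obtain ⟨m, rfl⟩ : ∃ m, l = m + 1 := ⟨l - 1, by omega⟩
    rw [gs, ← h1]; congr 1; omega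
  · intro i hi
    rcases i with _ | i
    · rw [g0, gs, Nat.sub_zero, hl, h1]; exact hs _ _ hA
    · rw [gs, gs]
      apply hs
      have := hp (l - (i + 1)) (by omega)
      rwa [show l - (i + 1) + 1 = l - i by omega] at this
  · intro i j hij hj hn he
    obtain ⟨j, rfl⟩ : ∃ k, j = k + 1 := ⟨j - 1, by omega⟩
    rcases i with _ | i
    · rw [g0, gs] at he
      exact hsim 1 (l - j) (by omega) (by omega) (by omega) he
    · rw [gs, gs] at he
      exact hsim (l - j) (l - i) (by omega) (by omega) (by omega) he.symm

lemma hH_of {ω : EdgeIdx N → Bool} {r : ℕ} {X K : ℝ} {y : Fin N}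
    (hX : X ≤ (degA (Adj ω) y : ℝ)) (hc : ((S1cycA (Adj ω) r y).ncard : ℝ) ≤ K)
    (hB : ({z | Bad ω r X y z}.ncard : ℝ) ≤ (degA (Adj ω) y : ℝ) / 2 - K) :
    (degA (Adj ω) y : ℝ) / 2 ≤
      ({z | AdjPA (Adj ω) r y z ∧ (degA (Adj ω) z : ℝ) < X}.ncard : ℝ) := by
  have hsub : {z | Adj ω y z} ⊆ {z | AdjPA (Adj ω) r y z ∧ (degA (Adj ω) z : ℝ) < X} ∪
      (S1cycA (Adj ω) r y ∪ {z | Bad ω r X y z}) := by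
    intro z hz
    have hz : Adj ω y z := hz
    by_cases h1 : z ∈ S1cycA (Adj ω) r y
    · exact Or.inr (Or.inl h1)
    by_cases h2 : Bad ω r X y z
    · exact Or.inr (Or.inr h2)
    left
    have h3 : (degA (Adj ω) z : ℝ) < X := by
      by_contra h
      exact h2 ⟨hz, h1, Or.inl (not_lt.1 h)⟩
    have h4 : ∀ t, t ≠ y → Adj ω z t → (degA (Adj ω) t : ℝ) < X := by
      intro t ht hzt
      by_contra h
      exact h2 ⟨hz, h1, Or.inr ⟨t, ht, hzt, not_lt.1 h⟩⟩
    refine ⟨⟨⟨hz, h1, fun h => h1 (S1cyc_symm (Adj_symm ω) h)⟩, ?_, ?_⟩, h3⟩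
    · rintro ⟨-, -, -, t, hzt, -, hyt⟩
      have hty : t ≠ y := by rintro rfl; exact precA_irrefl hyt
      have h5 := h4 t hty hzt
      have h6 : degA (Adj ω) y ≤ degA (Adj ω) t := by
        rcases hyt with h | h
        · exact h.le
        · exact h.1.le
      have h7 : (degA (Adj ω) y : ℝ) ≤ degA (Adj ω) t := by exact_mod_cast h6
      linarith
    · rintro ⟨-, -, hyz, -⟩
      have h6 : degA (Adj ω) y ≤ degA (Adj ω) z := by
        rcases hyz with h | h
        · exact h.le
        · exact h.1.le
      have h7 : (degA (Adj ω) y : ℝ) ≤ degA (Adj ω) z := by exact_mod_cast h6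
      linarith
  have h1 := (Set.ncard_le_ncard hsub).trans ((Set.ncard_union_le _ _).trans
    (Nat.add_le_add_left (Set.ncard_union_le _ _) _))
  have h2 : (degA (Adj ω) y : ℝ) ≤
      ({z | AdjPA (Adj ω) r y z ∧ (degA (Adj ω) z : ℝ) < X}.ncard : ℝ) +
      (((S1cycA (Adj ω) r y).ncard : ℝ) + ({z | Bad ω r X y z}.ncard : ℝ)) := by
    exact_mod_cast h1
  linarith

lemma prod_Vy (y : Fin N) (P : Fin N → Prop) (hP : ¬ P y) (a : ℝ) :
    (∏ z : Vy y, if P z then a else 1) = a ^ {z | P z}.ncard := by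
  have h1 : (∏ z : Vy y, if P z then a else 1) = ∏ z ∈ Finset.univ.erase y, if P z then a else 1 := by
    rw [Finset.prod_subtype (Finset.univ.erase y) (p := fun z => z ≠ y)]
    intro x; simp
  have h2 := Finset.mul_prod_erase Finset.univ (fun z => if P z then a else 1) (Finset.mem_univ y)
  rw [if_neg hP, one_mul] at h2
  rw [h1, h2, ← Finset.prod_filter, Finset.prod_const, Set.ncard_eq_toFinset_card']
  congr 2
  ext; simp

variable {w : Fin N → ℝ}

lemma bad_tail (hw : ∀ x, 0 < w x) {r : ℕ} {X b K : ℝ} (hb : 4 ≤ b) (y : Fin N)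
    (hE : Ex w (fun ω => (∏ z : Vy y, if Adj ω y z then (1 / 2 : ℝ) else 1) *
      ∏ z : Vy y, if Bad ω r X y z then b else 1) ≤ 1) :
    (b ^ (-K) * (√b / 2) ^ X) * Pr w (fun ω => X ≤ (degA (Adj ω) y : ℝ) ∧
      (degA (Adj ω) y : ℝ) / 2 - K ≤ ({z | Bad ω r X y z}.ncard : ℝ)) ≤ 1 := by
  have hb0 : 0 < b := by linarith
  have hsb : 2 ≤ √b := by
    rw [show (2:ℝ) = √4 by rw [show (4:ℝ) = 2 ^ 2 by norm_num]; simp]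
    exact Real.sqrt_le_sqrt hb
  refine le_trans (Pr_markov hw _ _ _ ?_ ?_) hE
  · intro ω
    refine mul_nonneg ?_ ?_
    · exact Finset.prod_nonneg fun z _ => by split_ifs <;> norm_num
    · exact Finset.prod_nonneg fun z _ => by split_ifs <;> linarith
  · rintro ω ⟨h1, h2⟩
    rw [prod_Vy y (fun z => Adj ω y z) (Adj_irrefl ω y),
      prod_Vy y (fun z => Bad ω r X y z) (fun h => Adj_irrefl ω y h.1)]
    change _ ≤ (1 / 2 : ℝ) ^ (degA (Adj ω) y) * _
    set D := degA (Adj ω) y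
    have h3 : b ^ ((D : ℝ) / 2 - K) ≤ b ^ {z | Bad ω r X y z}.ncard := by
      rw [← Real.rpow_natCast b]
      exact Real.rpow_le_rpow_of_exponent_le (by linarith) h2
    have h4 : (√b / 2) ^ X ≤ (√b / 2) ^ (D : ℝ) :=
      Real.rpow_le_rpow_of_exponent_le (by linarith) h1
    calc b ^ (-K) * (√b / 2) ^ X ≤ b ^ (-K) * (√b / 2) ^ (D : ℝ) :=
          mul_le_mul_of_nonneg_left h4 (by positivity)
      _ = (1 / 2 : ℝ) ^ D * b ^ ((D : ℝ) / 2 - K) := by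
          rw [show (D : ℝ) / 2 - K = -K + (1 / 2) * D by ring, Real.rpow_add hb0,
            Real.rpow_mul hb0.le, ← Real.sqrt_eq_rpow, Real.rpow_natCast, Real.rpow_natCast,
            div_pow, div_pow, one_pow]
          ring
      _ ≤ _ := mul_le_mul_of_nonneg_left h3 (by positivity)

theorem fail_bound (hw : ∀ x, 0 < w x) {r : ℕ} (hr : 6 ≤ r) {ν δ X b η q : ℝ} (k : ℕ)
    (hXe : X = xi ν δ N) (hX : 2 < X) (hb : 4 ≤ b)
    (hS1 : ∀ y x, w y * w x ≤ ∑ z, w z) (hS2 : ∀ y, 2 * w y ≤ ∑ z, w z)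
    (hM : 4 * (b - 1) * (1 + (∑ x, w x ^ 2) / ∑ x, w x) * ((∑ x, w x ^ 2) / ∑ x, w x) ≤ X - 2)
    (hη : ∀ y v, w y * w v / (∑ z, w z) *
      ∑ m ∈ Finset.range (2 * r + 1), ((∑ z, w z ^ 2) / ∑ z, w z) ^ m ≤ η)
    (hq : 0 < q) (hq1 : ((1 + 2 * r * k) * η) ^ k ≤ q)
    (hq2 : 1 ≤ q * (b ^ (-(2 * k : ℝ)) * (√b / 2) ^ X)) :
    Pr w (fun ω => ¬ opNorm ((1 - PiPA (Adj ω) r ν δ) * adjMatrixPA (Adj ω) r *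
      (1 - PiPA (Adj ω) r ν δ)) ≤ 160 * √X) ≤ N * (2 * q) := by
  have hun := Pr_union hw (Finset.univ : Finset (Fin N))
    (fun ω => ¬ opNorm ((1 - PiPA (Adj ω) r ν δ) * adjMatrixPA (Adj ω) r *
      (1 - PiPA (Adj ω) r ν δ)) ≤ 160 * √X)
    (fun y ω => 2 * k ≤ (S1cycA (Adj ω) r y).ncard ∨ (X ≤ (degA (Adj ω) y : ℝ) ∧
      (degA (Adj ω) y : ℝ) / 2 - 2 * k ≤ ({z | Bad ω r X y z}.ncard : ℝ))) (by
      intro ω hω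
      by_contra hcon
      push Not at hcon
      apply hω
      refine det_bound (Adj_symm ω) (by linarith) ?_ (Adj_irrefl ω) hXe
      intro y hy
      obtain ⟨h1, h2⟩ := hcon y (Finset.mem_univ y)
      refine hH_of (K := 2 * k) hy (by exact_mod_cast h1.le) (h2 hy).le)
  refine hun.trans ?_
  have : ∀ y ∈ (Finset.univ : Finset (Fin N)),
      Pr w (fun ω => 2 * k ≤ (S1cycA (Adj ω) r y).ncard ∨ (X ≤ (degA (Adj ω) y : ℝ) ∧
      (degA (Adj ω) y : ℝ) / 2 - 2 * k ≤ ({z | Bad ω r X y z}.ncard : ℝ))) ≤ 2 * q := by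
    intro y _
    refine (Pr_or hw _ _).trans ?_
    have h1 := (cyc_bound hw r y η (hη y) k).trans hq1
    have h2 := bad_tail (K := 2 * k) hw hb y
      (expmom_le_one hw hr hX (by linarith) y (hS1 y) (hS2 y) hM)
    set c := b ^ (-(2 * k : ℝ)) * (√b / 2) ^ X
    set p := Pr w (fun ω => X ≤ (degA (Adj ω) y : ℝ) ∧
      (degA (Adj ω) y : ℝ) / 2 - 2 * k ≤ ({z | Bad ω r X y z}.ncard : ℝ))
    have hp0 : 0 ≤ p := Pr_nonneg hw _
    have h3 : p ≤ q := by
      calc p ≤ (q * c) * p := le_mul_of_one_le_left hp0 hq2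
        _ = q * (c * p) := by ring
        _ ≤ q * 1 := mul_le_mul_of_nonneg_left h2 hq.le
        _ = q := mul_one q
    linarith
  refine (Finset.sum_le_sum this).trans (le_of_eq ?_)
  simp

end combine
end GRG

namespace GRG
section asym
open Classical Filter

lemma ev_facts (c0 K κ θ a ε K2 : ℝ) (n : ℕ) (hc0 : 0 < c0) (hK : 0 < K) (hκ : 0 < κ)
    (hθ : 0 < θ) (hε : 0 < ε) (hK2 : 0 < K2) (ha : 0 < a) :
    ∀ᶠ L : ℝ in atTop, 1 < L ∧ 0 < log L ∧ log L ≤ c0 / (K + 2) * L ^ (1 / 9 : ℝ) ∧ 4 ≤ L ^ κ ∧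
      2 * c0 * log 2 / θ ≤ log L ∧ a * log L ≤ θ / 2 * L ∧ K2 * L ^ n ≤ exp (ε / 2 * L) := by
  have h1 : ∀ᶠ L : ℝ in atTop, 1 < L := eventually_gt_atTop 1
  have h2 : ∀ᶠ L : ℝ in atTop, 0 < log L := Real.tendsto_log_atTop.eventually_gt_atTop 0
  have h3 := (isLittleO_log_rpow_atTop (by norm_num : (0:ℝ) < 1 / 9)).def
    (by positivity : 0 < c0 / (K + 2))
  have h4 := (tendsto_rpow_atTop hκ).eventually_ge_atTop 4
  have h5 := Real.tendsto_log_atTop.eventually_ge_atTop (2 * c0 * log 2 / θ)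
  have h6 := (Real.isLittleO_log_id_atTop).def (by positivity : 0 < θ / 2 / a)
  have h7 := (isLittleO_pow_exp_pos_mul_atTop (k := n) (by positivity : 0 < ε / 2)).def
    (by positivity : 0 < 1 / K2)
  filter_upwards [h1, h2, h3, h4, h5, h6, h7] with L l1 l2 l3 l4 l5 l6 l7
  have hL : 0 < L := by linarith
  refine ⟨l1, l2, ?_, l4, l5, ?_, ?_⟩
  · rwa [Real.norm_of_nonneg l2.le, Real.norm_of_nonneg (by positivity)] at l3
  · rw [Real.norm_of_nonneg l2.le, id, Real.norm_of_nonneg hL.le] at l6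
    calc a * log L ≤ a * (θ / 2 / a * L) := mul_le_mul_of_nonneg_left l6 ha.le
      _ = _ := by field_simp
  · rw [Real.norm_of_nonneg (by positivity), Real.norm_of_nonneg (exp_pos _).le] at l7
    calc K2 * L ^ n ≤ K2 * (1 / K2 * exp (ε / 2 * L)) := mul_le_mul_of_nonneg_left l7 hK2.le
      _ = _ := by field_simp

set_option maxHeartbeats 2000000 in
theorem main_large (ε δ : ℝ) (hε : 0 < ε) (hδ : 0 < δ) (hδ' : δ < 1 / 3)
    (r : ℕ) (hr : 6 ≤ r)
    (w : (N : ℕ) → Fin N → ℝ)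
    (hpos : ∀ N x, 0 < w N x)
    (hA1 : ∀ N x, w N x ≤ (N : ℝ) ^ ((1 : ℝ) / 2 - ε))
    (hA2m1 : ∀ N : ℕ, 1 ≤ N → (N : ℝ) ^ (-ε) ≤ m1 (w N))
    (C : ℝ) (hC : 0 < C) (hA2m2 : ∀ N : ℕ, 2 ≤ N → m2 (w N) / m1 (w N) ≤ C * Real.log N ^ δ)
    (ν : ℝ) (hν : 0 < ν) :
    ∀ᶠ N : ℕ in atTop, Pr (w N) (fun ω => ¬ opNorm ((1 - PiPA (Adj ω) r ν δ) *
      adjMatrixPA (Adj ω) r * (1 - PiPA (Adj ω) r ν δ)) ≤ 160 * √(xi ν δ N)) ≤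
      2 * (N : ℝ) ^ (-ν) := by
  set c0 : ℝ := 3 * (ν + 1) * (2 - 3 * δ) / ((1 - δ) * (1 - 2 * δ)) with hc0d
  set κ : ℝ := 2 / 3 * (1 - 2 * δ) with hκd
  set θ : ℝ := (ν + 1) * (1 - 2 * δ) / (1 - δ) with hθd
  have d1 : 0 < 1 - δ := by linarith
  have d2 : 0 < 1 - 2 * δ := by linarith
  have d3 : 0 < 2 - 3 * δ := by linarith
  have hc0 : 0 < c0 := by positivity
  have hκ : 0 < κ := by positivity
  have hθ : 0 < θ := by positivity
  have hid : c0 * (κ / 2) = (ν + 1) + θ := by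
    rw [hc0d, hκd, hθd]; field_simp; ring
  obtain ⟨k, hk⟩ := exists_nat_ge (2 * (ν + 1) / ε)
  have hk1 : ν + 1 ≤ ε / 2 * k := by
    rw [div_le_iff₀ hε] at hk; linarith
  have hk0 : 0 < (k : ℝ) := lt_of_lt_of_le (by positivity) hk
  set K : ℝ := 4 * (1 + C) ^ 2 with hKd
  set K2 : ℝ := (1 + 2 * r * k) * ((2 * r + 1) * (1 + C) ^ (2 * r)) with hK2d
  have hev := ev_facts c0 K κ θ (2 * k * κ) ε K2 (2 * r) hc0 (by positivity) hκ hθ hε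
    (by positivity) (by positivity)
  have hev' := (Real.tendsto_log_atTop.comp tendsto_natCast_atTop_atTop).eventually hev
  filter_upwards [hev', eventually_ge_atTop 4] with N hN hN4
  simp only [Function.comp_apply] at hN
  set L := log (N : ℝ) with hL
  obtain ⟨l1, l2, l3, l4, l5, l6, l7⟩ := hN
  have hL0 : 0 < L := by linarith
  have hN4' : (4 : ℝ) ≤ N := by exact_mod_cast hN4
  have hN0 : (0 : ℝ) < N := by linarith
  have hNr : ∀ s : ℝ, (N : ℝ) ^ s = exp (L * s) := fun s => Real.rpow_def_of_pos hN0 s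
  -- weights
  set S := ∑ z, w N z with hS
  set M := (∑ z, w N z ^ 2) / S with hM
  have hSge : (N : ℝ) ^ (1 - ε) ≤ S := by
    have h := hA2m1 N (by omega)
    unfold m1 at h
    rw [le_div_iff₀ hN0, ← hS] at h
    rwa [show 1 - ε = -ε + 1 by ring, Real.rpow_add_one hN0.ne']
  have hSp : 0 < S := lt_of_lt_of_le (by positivity) hSge
  have hMle : M ≤ C * L ^ δ := by
    have h := hA2m2 N (by omega)
    unfold m1 m2 at h
    rwa [div_div_div_cancel_right₀ hN0.ne'] at h
  have hM0 : 0 ≤ M := div_nonneg (Finset.sum_nonneg fun z _ => sq_nonneg _) hSp.le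
  have hLd1 : 1 ≤ L ^ δ := Real.one_le_rpow l1.le hδ.le
  have hLdL : L ^ δ ≤ L := by
    conv_rhs => rw [← Real.rpow_one L]
    exact Real.rpow_le_rpow_of_exponent_le l1.le (by linarith)
  have hM1 : 1 + M ≤ (1 + C) * L ^ δ := by nlinarith
  have hww : ∀ y x, w N y * w N x ≤ (N : ℝ) ^ (1 - 2 * ε) := by
    intro y x
    calc w N y * w N x ≤ (N : ℝ) ^ ((1 : ℝ) / 2 - ε) * (N : ℝ) ^ ((1 : ℝ) / 2 - ε) :=
          mul_le_mul (hA1 N y) (hA1 N x) (hpos N x).le (by positivity)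
      _ = _ := by rw [← Real.rpow_add hN0]; congr 1; ring
  set b : ℝ := L ^ κ with hb
  have hXd : xi ν δ N = c0 * (L / log L) := rfl
  have hXlow : (K + 2) * L ^ (8 / 9 : ℝ) ≤ c0 * (L / log L) := by
    rw [← mul_div_assoc, le_div_iff₀ l2]
    have hKp : 0 < K + 2 := by positivity
    calc (K + 2) * L ^ (8 / 9 : ℝ) * log L
        ≤ (K + 2) * L ^ (8 / 9 : ℝ) * (c0 / (K + 2) * L ^ (1 / 9 : ℝ)) :=
          mul_le_mul_of_nonneg_left l3 (by positivity)
      _ = c0 * (L ^ (8 / 9 : ℝ) * L ^ (1 / 9 : ℝ)) := by field_simp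
      _ = c0 * L := by rw [← Real.rpow_add hL0]; norm_num
  have hL89 : 1 ≤ L ^ (8 / 9 : ℝ) := Real.one_le_rpow l1.le (by norm_num)
  have hKp : 0 < K := by positivity
  have hq : (0 : ℝ) < (N : ℝ) ^ (-(ν + 1)) := by positivity
  have hfin := fail_bound (w := w N) (hpos N) hr (ν := ν) (δ := δ) (X := xi ν δ N) (b := b)
    (η := (N : ℝ) ^ (-ε) * ((2 * r + 1) * ((1 + C) * L) ^ (2 * r)))
    (q := (N : ℝ) ^ (-(ν + 1))) k rfl ?_ l4 ?_ ?_ ?_ ?_ hq ?_ ?_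
  · refine hfin.trans (le_of_eq ?_)
    have : (N : ℝ) ^ (-ν) = (N : ℝ) ^ (-(ν + 1)) * N := by
      rw [← Real.rpow_add_one hN0.ne']; congr 1; ring
    rw [this]; ring
  · rw [hXd]; nlinarith
  · intro y x
    refine (hww y x).trans (le_trans ?_ hSge)
    exact Real.rpow_le_rpow_of_exponent_le (by linarith) (by linarith)
  · intro y
    refine le_trans ?_ hSge
    have h1 : (2 : ℝ) ≤ (N : ℝ) ^ (1 / 2 : ℝ) := by
      rw [← Real.sqrt_eq_rpow]
      exact Real.le_sqrt_of_sq_le (by linarith)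
    calc 2 * w N y ≤ (N : ℝ) ^ (1 / 2 : ℝ) * (N : ℝ) ^ ((1 : ℝ) / 2 - ε) :=
          mul_le_mul h1 (hA1 N y) (hpos N y).le (by positivity)
      _ = _ := by rw [← Real.rpow_add hN0]; congr 1; ring
  · rw [← hS, ← hM, hXd]
    have hs1 : (L ^ κ) * (L ^ δ * L ^ δ) ≤ L ^ (8 / 9 : ℝ) := by
      rw [← Real.rpow_add hL0, ← Real.rpow_add hL0]
      apply Real.rpow_le_rpow_of_exponent_le l1.le
      rw [hκd]; linarith
    have h1 : 4 * (b - 1) * (1 + M) * M ≤ K * ((L ^ κ) * (L ^ δ * L ^ δ)) := by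
      have ha : (1 + M) * M ≤ ((1 + C) * L ^ δ) * ((1 + C) * L ^ δ) :=
        mul_le_mul hM1 (by linarith) hM0 (by positivity)
      calc 4 * (b - 1) * (1 + M) * M = 4 * (b - 1) * ((1 + M) * M) := by ring
        _ ≤ 4 * b * (((1 + C) * L ^ δ) * ((1 + C) * L ^ δ)) :=
          mul_le_mul (by linarith) ha (by positivity) (by linarith)
        _ = _ := by rw [hKd, hb]; ring
    have h2 : K * ((L ^ κ) * (L ^ δ * L ^ δ)) ≤ K * L ^ (8 / 9 : ℝ) :=
      mul_le_mul_of_nonneg_left hs1 hKp.le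
    nlinarith
  · intro y v
    rw [← hS, ← hM]
    apply mul_le_mul
    · rw [div_le_iff₀ hSp]
      refine (hww y v).trans ?_
      calc (N : ℝ) ^ (1 - 2 * ε) = (N : ℝ) ^ (-ε) * (N : ℝ) ^ (1 - ε) := by
            rw [← Real.rpow_add hN0]; congr 1; ring
        _ ≤ _ := mul_le_mul_of_nonneg_left hSge (by positivity)
    · have hb1 : 1 + M ≤ (1 + C) * L := hM1.trans (mul_le_mul_of_nonneg_left hLdL (by positivity))
      have : ∀ m ∈ Finset.range (2 * r + 1), M ^ m ≤ ((1 + C) * L) ^ (2 * r) := by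
        intro m hm
        have hm' : m ≤ 2 * r := by have := Finset.mem_range.1 hm; omega
        calc M ^ m ≤ ((1 + C) * L) ^ m := pow_le_pow_left₀ hM0 (by linarith) m
          _ ≤ _ := pow_le_pow_right₀ (by linarith) hm'
      refine (Finset.sum_le_sum this).trans (le_of_eq ?_)
      simp
    · positivity
    · positivity
  · have h1 : (1 + 2 * r * k) * ((N : ℝ) ^ (-ε) * ((2 * r + 1) * ((1 + C) * L) ^ (2 * r))) ≤
        exp (-(ε / 2) * L) := by
      calc _ = (N : ℝ) ^ (-ε) * (K2 * L ^ (2 * r)) := by rw [hK2d, mul_pow]; ring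
        _ ≤ (N : ℝ) ^ (-ε) * exp (ε / 2 * L) := mul_le_mul_of_nonneg_left l7 (by positivity)
        _ = _ := by rw [hNr, ← Real.exp_add]; congr 1; ring
    calc _ ≤ exp (-(ε / 2) * L) ^ k := pow_le_pow_left₀ (by positivity) h1 k
      _ = exp (k * (-(ε / 2) * L)) := by rw [← Real.exp_nat_mul]
      _ ≤ _ := by
        rw [hNr, Real.exp_le_exp]
        nlinarith
  · have hbp : 0 < b := by positivity
    have e1 : b ^ (-(2 * k : ℝ)) = exp (-(2 * k * κ * log L)) := by
      rw [hb, ← Real.rpow_mul hL0.le, Real.rpow_def_of_pos hL0]; congr 1; ring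
    have e2 : √b / 2 = exp (κ / 2 * log L - log 2) := by
      rw [Real.exp_sub, Real.exp_log (by norm_num), hb, Real.sqrt_eq_rpow, ← Real.rpow_mul hL0.le,
        Real.rpow_def_of_pos hL0]
      congr 2; ring
    rw [e1, e2, hNr, ← Real.exp_mul, ← Real.exp_add, ← Real.exp_add, Real.one_le_exp_iff, hXd]
    have e3 : (κ / 2 * log L - log 2) * (c0 * (L / log L)) =
        (c0 * (κ / 2)) * L - c0 * log 2 * L / log L := by
      field_simp
    have e4 : c0 * log 2 * L / log L ≤ θ / 2 * L := by
      rw [div_le_iff₀ l2]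
      rw [div_le_iff₀ hθ] at l5
      nlinarith
    rw [e3, hid]
    nlinarith

lemma opNorm_zero_dim (M : Matrix (Fin 0) (Fin 0) ℝ) : opNorm M = 0 := by
  have : M = 0 := Subsingleton.elim _ _
  rw [this]; unfold opNorm; simp

end asym
end GRG

open GRG in
/-- Norm bound on the complementary block.
Under (A1) and (A2), for every `ν > 0` there is `C_ν > 0` such that with `ν`-high
probability `‖Π̄^p A^p Π̄^p‖ ≤ C_ν √(log N / log log N)`. -/
theorem norm_complementary_block
    (ε δ : ℝ) (hε : 0 < ε) (hε' : ε < 1 / 2) (hδ : 0 < δ) (hδ' : δ < 1 / 3)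
    (r : ℕ) (hr : 6 ≤ r)
    (w : (N : ℕ) → Fin N → ℝ)
    (hpos : ∀ N x, 0 < w N x)
    (hA1 : ∀ N x, w N x ≤ (N : ℝ) ^ ((1 : ℝ) / 2 - ε))
    (hA2m1 : ∀ N : ℕ, 1 ≤ N → (N : ℝ) ^ (-ε) ≤ m1 (w N))
    (hA2m2 : ∃ C > 0, ∀ N : ℕ, 2 ≤ N → m2 (w N) / m1 (w N) ≤ C * Real.log N ^ δ)
    (ν : ℝ) (hν : 0 < ν) :
    ∃ Cν > (0 : ℝ), ∃ C > (0 : ℝ), ∀ N : ℕ,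
      1 - ENNReal.ofReal (C * (N : ℝ) ^ (-ν)) ≤
        grgMeasure (w N) {ω |
          opNorm ((1 - PiPA (Adj ω) r ν δ) * adjMatrixPA (Adj ω) r *
              (1 - PiPA (Adj ω) r ν δ)) ≤
            Cν * Real.sqrt (Real.log N / Real.log (Real.log N))} := by
  obtain ⟨C, hC, hCm⟩ := hA2m2
  obtain ⟨N0, hN0⟩ := Filter.eventually_atTop.1
    (main_large ε δ hε hδ hδ' r hr w hpos hA1 hA2m1 C hC hCm ν hν)
  have hc0 : 0 < 3 * (ν + 1) * (2 - 3 * δ) / ((1 - δ) * (1 - 2 * δ)) := by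
    have d1 : 0 < 1 - δ := by linarith
    have d2 : 0 < 1 - 2 * δ := by linarith
    have d3 : 0 < 2 - 3 * δ := by linarith
    positivity
  set c0 := 3 * (ν + 1) * (2 - 3 * δ) / ((1 - δ) * (1 - 2 * δ)) with hc0d
  refine ⟨160 * √c0, by positivity, 2 + (N0 : ℝ) ^ ν, by positivity, ?_⟩
  intro N
  rcases Nat.eq_zero_or_pos N with rfl | hN
  · have h1 : ∀ ω : EdgeIdx 0 → Bool, ω ∈ {ω : EdgeIdx 0 → Bool |
          opNorm ((1 - PiPA (Adj ω) r ν δ) * adjMatrixPA (Adj ω) r *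
              (1 - PiPA (Adj ω) r ν δ)) ≤
            160 * √c0 * Real.sqrt (Real.log (0 : ℕ) / Real.log (Real.log (0 : ℕ)))} := by
      intro ω
      rw [Set.mem_ofPred_eq, opNorm_zero_dim]
      positivity
    have h2 : Pr (w 0) (fun _ => True) = 1 := by
      unfold Pr; simpa using Ex_one (w := w 0)
    rw [grgMeasure_eq (hpos 0)]
    simp only [h1, h2]
    simp
  rcases Nat.lt_or_ge N N0 with hlt | hge
  · have hN' : (0 : ℝ) < N := by exact_mod_cast hN
    have : 1 ≤ (2 + (N0 : ℝ) ^ ν) * (N : ℝ) ^ (-ν) := by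
      have h1 : (N : ℝ) ^ ν ≤ (N0 : ℝ) ^ ν :=
        Real.rpow_le_rpow hN'.le (by exact_mod_cast hlt.le) hν.le
      rw [Real.rpow_neg hN'.le, ← div_eq_mul_inv, le_div_iff₀ (by positivity)]
      linarith
    rw [tsub_eq_zero_of_le (by rw [← ENNReal.ofReal_one]; exact ENNReal.ofReal_le_ofReal this)]
    exact zero_le
  · have h := hN0 N hge
    have hX : √(xi ν δ N) = √c0 * √(Real.log N / Real.log (Real.log N)) := by
      unfold xi
      rw [Real.sqrt_mul hc0.le]
    rw [hX, ← mul_assoc] at h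
    rw [grgMeasure_eq (hpos N), ← ENNReal.ofReal_one, ← ENNReal.ofReal_sub _ (by positivity)]
    apply ENNReal.ofReal_le_ofReal
    rw [Pr_compl]
    have h3 : 0 ≤ (N0 : ℝ) ^ ν * (N : ℝ) ^ (-ν) := by positivity
    simp only [Set.mem_ofPred_eq]
    nlinarith
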